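/- arXiv:2102.02010 — 3 statements merged into one kernel-verified Lean document; each statement's English description precedes it below -/
import Mathlib

section
/- Let S be a tree with at least 17 vertices that is not a caterpillar, and fix an embedding of a tree S' with |S'| = |S| in a tree T. There exists a set X of at most 144 vertices of T such that if an embedding of S in T can be obtained by moving three or fewer edges of S', then each hub of the obtained embedding of S is contained in X. -/
open SimpleGraph Filter

/-- The degree of a vertex, as the cardinality of its neighbour set. -/
noncomputable def ndeg {V : Type*} (G : SimpleGraph V) (v : V) : ℕ :=
  (G.neighborSet v).ncard

/-- `Z_k(G)`: the number of `k`-vertex subtrees (connected subgraphs) of `G`. -/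
noncomputable def subtreeCount {V : Type*} [Fintype V] (G : SimpleGraph V) (k : ℕ) : ℕ :=
  {s : Finset V | s.card = k ∧ (G.induce (s : Set V)).Connected}.ncard

/-- The number of embeddings (subtrees isomorphic to `S`) of a tree `S` in `G`,
counted among `k`-vertex subtrees. -/
noncomputable def embCount {V W : Type*} [Fintype V] (G : SimpleGraph V)
    (S : SimpleGraph W) (k : ℕ) : ℕ :=
  {s : Finset V | s.card = k ∧ Nonempty ((G.induce (s : Set V)) ≃g S)}.ncard

/-- The density `d(S,T)`: the number of embeddings of the `|S|`-vertex tree `S` in `T`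
divided by the number of `|S|`-vertex subtrees of `T` (`0` if `T` has fewer vertices). -/
noncomputable def density {V W : Type*} [Fintype V] [Fintype W]
    (S : SimpleGraph W) (T : SimpleGraph V) : ℝ :=
  (embCount T S (Fintype.card W) : ℝ) / (subtreeCount T (Fintype.card W) : ℝ)

/-- `max { d(S,T) : T an n-vertex tree }`. -/
noncomputable def maxDensity {W : Type*} [Fintype W] (S : SimpleGraph W) (n : ℕ) : ℝ :=
  sSup {x : ℝ | ∃ T : SimpleGraph (Fin n), T.IsTree ∧ x = density S T}

/-- The inducibility of `S`: `limsup_{n → ∞} max { d(S,T) : T an n-vertex tree }`. -/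
noncomputable def inducibility {W : Type*} [Fintype W] (S : SimpleGraph W) : ℝ :=
  Filter.limsup (maxDensity S) Filter.atTop

/-- A graph is starlike if it has at most one non-leaf vertex. -/
def IsStarlike {V : Type*} (G : SimpleGraph V) : Prop :=
  {v | ndeg G v ≠ 1}.Subsingleton

/-- A graph is pathlike if its maximum degree is at most 2. -/
def IsPathlike {V : Type*} (G : SimpleGraph V) : Prop :=
  ∀ v, ndeg G v ≤ 2

/-- The vertex set of the component of `u` in `G - v`; together with the edge `uv`, this is
the branch of `G` rooted at `v` through its neighbour `u`. -/
def branchSet {V : Type*} (G : SimpleGraph V) (v u : V) : Set V :=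
  {w | ∃ p : G.Walk u w, v ∉ p.support}

/-- The branch of `G` rooted at `v` through `u` is non-trivial if it is not a single edge. -/
def NontrivialBranch {V : Type*} (G : SimpleGraph V) (v u : V) : Prop :=
  G.Adj v u ∧ branchSet G v u ≠ {u}

/-- The branch rooted at `v` through `u` is a fork: non-trivial and isomorphic to a star in
which `v` is a leaf (all vertices of the branch other than `u` and `v` are leaves of `G`). -/
def IsFork {V : Type*} (G : SimpleGraph V) (v u : V) : Prop :=
  NontrivialBranch G v u ∧ ∀ w ∈ branchSet G v u, w ≠ u → ndeg G w = 1

/-- The order of a fork: its number of leaves other than the root. -/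
noncomputable def forkOrder {V : Type*} (G : SimpleGraph V) (v u : V) : ℕ :=
  (branchSet G v u).ncard - 1

/-- A branch is major if it is non-trivial and not a fork. -/
def IsMajor {V : Type*} (G : SimpleGraph V) (v u : V) : Prop :=
  NontrivialBranch G v u ∧ ¬ IsFork G v u

/-- A caterpillar is a tree in which every vertex is the root of at most two
non-trivial branches. -/
def IsCaterpillar {V : Type*} (G : SimpleGraph V) : Prop :=
  G.IsTree ∧ ∀ v, {u | NontrivialBranch G v u}.ncard ≤ 2

/-- A center of `G`: each branch rooted at `v` has at most `|G|/2` edges (the branch through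
a neighbour `u` has `(branchSet G v u).ncard` edges). -/
def IsCenter {V : Type*} [Fintype V] (G : SimpleGraph V) (v : V) : Prop :=
  ∀ u, G.Adj v u → 2 * (branchSet G v u).ncard ≤ Fintype.card V

/-- `v` is the root of at least three non-trivial branches. -/
def RootsThreeNontrivial {V : Type*} (G : SimpleGraph V) (v : V) : Prop :=
  3 ≤ {u | NontrivialBranch G v u}.ncard

/-- A hub of `G`: a vertex `v` that is the only vertex on the path from `v` to the nearest
center of `G` that is the root of at least three non-trivial branches.  (A vertex `w` lies on
the path from `v` to `c` iff `dist v w + dist w c = dist v c`.) -/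
def IsHub {V : Type*} [Fintype V] (G : SimpleGraph V) (v : V) : Prop :=
  RootsThreeNontrivial G v ∧
  ∃ c, IsCenter G c ∧ (∀ c', IsCenter G c' → G.dist v c ≤ G.dist v c') ∧
    ∀ w, G.dist v w + G.dist w c = G.dist v c → w ≠ v → ¬ RootsThreeNontrivial G w


namespace SimpleGraph

section Metric

variable {V : Type*} {T : SimpleGraph V}

theorem IsTree.length_eq_dist (hT : T.IsTree) {x y : V} {p : T.Walk x y} (hp : p.IsPath) :
    p.length = T.dist x y := by
  obtain ⟨q, hq, hql⟩ := hT.connected.exists_path_of_dist x y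
  have h := (hT.isAcyclic.subsingleton_path x y).elim ⟨p, hp⟩ ⟨q, hq⟩
  rw [← hql, congrArg (fun r : T.Path x y => r.1.length) h]

theorem IsTree.getVert_eq_of_between (hT : T.IsTree) {a x y : V} {p : T.Walk x y} (hp : p.IsPath)
    (ha : T.dist x a + T.dist a y = T.dist x y) : p.getVert (T.dist x a) = a := by
  obtain ⟨q, hq, hql⟩ := hT.connected.exists_path_of_dist x a
  obtain ⟨r, hr, hrl⟩ := hT.connected.exists_path_of_dist a y
  have hqr : (q.append r).IsPath :=
    Walk.isPath_of_length_eq_dist _ (by rw [Walk.length_append, hql, hrl, ha])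
  have h := (hT.isAcyclic.subsingleton_path x y).elim ⟨p, hp⟩ ⟨q.append r, hqr⟩
  have h' : p = q.append r := congrArg Subtype.val h
  rw [h', Walk.getVert_append, ← hql]
  simp

theorem IsTree.between_unique (hT : T.IsTree) {a a' x y : V}
    (ha : T.dist x a + T.dist a y = T.dist x y) (ha' : T.dist x a' + T.dist a' y = T.dist x y)
    (h : T.dist x a = T.dist x a') : a = a' := by
  obtain ⟨p, hp, -⟩ := hT.connected.exists_path_of_dist x y
  rw [← hT.getVert_eq_of_between hp ha, ← hT.getVert_eq_of_between hp ha', h]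

theorem Connected.exists_between (hT : T.Connected) {x y : V} {k : ℕ} (hk : k ≤ T.dist x y) :
    ∃ a, T.dist x a = k ∧ T.dist a y = T.dist x y - k := by
  obtain ⟨p, hp, hpl⟩ := hT.exists_path_of_dist x y
  refine ⟨p.getVert k, ?_⟩
  have h1 : T.dist x (p.getVert k) ≤ k := by
    refine (dist_le (p.take k)).trans ?_
    simp
  have h2 : T.dist (p.getVert k) y ≤ T.dist x y - k := by
    refine (dist_le (p.drop k)).trans ?_
    simp [hpl]
  have h3 := hT.dist_triangle (u := x) (v := p.getVert k) (w := y)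
  omega

theorem Connected.exists_hop (hT : T.Connected) {x y : V} (h : x ≠ y) :
    ∃ u, T.dist x u = 1 ∧ T.dist x y = T.dist u y + 1 := by
  have h1 := hT.pos_dist_of_ne h
  obtain ⟨u, hu, hu'⟩ := hT.exists_between (x := x) (y := y) (k := 1) h1
  exact ⟨u, hu, by omega⟩

theorem IsTree.dist_step (hT : T.IsTree) {v u : V} (h : T.dist v u = 1) (x : V) :
    T.dist v x = T.dist u x + 1 ∨ T.dist u x = T.dist v x + 1 := by
  have := hT.dist_eq_dist_add_one_of_adj x (dist_eq_one_iff_adj.mp h)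
  rw [dist_comm (u := v), dist_comm (u := u)]
  exact this

theorem IsTree.dist_across (hT : T.IsTree) {v u y : V} (h : T.dist v u = 1)
    (hy : T.dist u y = T.dist v y + 1) : ∀ (n : ℕ) (x : V), T.dist u x = n →
    T.dist v x = T.dist u x + 1 → T.dist y x = T.dist y v + 1 + T.dist u x := by
  intro n
  induction n with
  | zero =>
    intro x hx hvx
    have : u = x := hT.connected.dist_eq_zero_iff.mp hx
    subst this
    rw [dist_comm (u := y), dist_comm (u := y)]
    simp [hy]
  | succ n ih =>
    intro x hx hvx
    have hne : x ≠ u := by rintro rfl; simp at hx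
    obtain ⟨z, hz1, hz2⟩ := hT.connected.exists_hop hne
    have tri := hT.connected.dist_triangle (u := v) (v := z) (w := x)
    have c1 := T.dist_comm (u := x) (v := u)
    have c2 := T.dist_comm (u := z) (v := u)
    have c3 := T.dist_comm (u := z) (v := x)
    have hvz : T.dist v z = T.dist u z + 1 := by
      rcases hT.dist_step h z with h' | h' <;> omega
    have hyz := ih z (by omega) hvz
    have c4 := T.dist_comm (u := y) (v := x)
    have c5 := T.dist_comm (u := y) (v := z)
    rcases hT.dist_step hz1 y with h' | h'
    · omega
    · exfalso
      rcases eq_or_ne z u with rfl | hzu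
      · have : x = v := hT.between_unique (x := z) (y := y) (by omega)
          (by have := T.dist_comm (u := z) (v := v); omega)
          (by have := T.dist_comm (u := z) (v := v); omega)
        subst this
        have := T.dist_self (v := x)
        omega
      · obtain ⟨t, ht1, ht2⟩ := hT.connected.exists_hop hzu
        have tri := hT.connected.dist_triangle (u := v) (v := t) (w := z)
        have c6 := T.dist_comm (u := t) (v := u)
        have c7 := T.dist_comm (u := t) (v := z)
        have c8 := T.dist_comm (u := t) (v := y)
        have hvt : T.dist v t = T.dist u t + 1 := by
          rcases hT.dist_step h t with h' | h' <;> omega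
        have tri2 := hT.connected.dist_triangle (u := y) (v := v) (w := t)
        have : x = t := hT.between_unique (x := z) (y := y) (by omega) (by
          have tri3 := hT.connected.dist_triangle (u := y) (v := t) (w := z)
          omega) (by omega)
        subst this
        omega

theorem IsTree.dist_across' (hT : T.IsTree) {v u x y : V} (h : T.dist v u = 1)
    (hy : T.dist u y = T.dist v y + 1) (hx : T.dist v x = T.dist u x + 1) :
    T.dist y x = T.dist y v + 1 + T.dist u x :=
  hT.dist_across h hy _ x rfl hx

end Metric

end SimpleGraph

section Induce

variable {V : Type*} {T : SimpleGraph V}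

/-- `GeodConvex T s`: the set `s` contains every vertex lying on a shortest path of `T` between
two of its elements. -/
def GeodConvex (T : SimpleGraph V) (s : Finset V) : Prop :=
  ∀ ⦃x y a : V⦄, x ∈ s → y ∈ s → T.dist x a + T.dist a y = T.dist x y → a ∈ s

theorem exists_isPath_of_induce_connected {s : Finset V} (hs : (T.induce (s : Set V)).Connected)
    (x y : (s : Set V)) :
    ∃ p : (T.induce (s : Set V)).Walk x y,
      (p.map (Embedding.induce (s : Set V)).toHom).IsPath ∧
        p.length = (T.induce (s : Set V)).dist x y := by
  obtain ⟨p, hp, hpl⟩ := hs.exists_path_of_dist x y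
  exact ⟨p, hp.map Subtype.val_injective, hpl⟩

theorem dist_induce (hT : T.IsTree) {s : Finset V} (hs : (T.induce (s : Set V)).Connected)
    (x y : (s : Set V)) : (T.induce (s : Set V)).dist x y = T.dist x y := by
  obtain ⟨p, hp, hpl⟩ := exists_isPath_of_induce_connected hs x y
  rw [← hpl, ← Walk.length_map (Embedding.induce (s : Set V)).toHom]
  exact hT.length_eq_dist hp

theorem geodConvex_of_connected (hT : T.IsTree) {s : Finset V}
    (hs : (T.induce (s : Set V)).Connected) : GeodConvex T s := by
  intro x y a hx hy ha
  obtain ⟨p, hp, -⟩ := exists_isPath_of_induce_connected hs ⟨x, hx⟩ ⟨y, hy⟩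
  have h := hT.getVert_eq_of_between hp ha
  rw [Walk.getVert_map] at h
  rw [← h]
  exact (p.getVert _).2

theorem mem_branchSet_iff {W : Type*} {G : SimpleGraph W} (hG : G.IsTree) {v u : W}
    (h : G.Adj v u) (x : W) : x ∈ branchSet G v u ↔ G.dist v x = G.dist u x + 1 := by
  classical
  constructor
  · rintro ⟨p, hp⟩
    have hb : v ∉ p.bypass.support := fun h' => hp (p.support_bypass_subset_support h')
    have h1 := hG.length_eq_dist p.bypass_isPath
    have h2 := hG.length_eq_dist (p.bypass_isPath.cons (h := h) hb)
    rw [Walk.length_cons] at h2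
    omega
  · intro hx
    obtain ⟨p, hp, hpl⟩ := hG.connected.exists_path_of_dist u x
    refine ⟨p, fun hv => ?_⟩
    have h1 := dist_le (p.dropUntil v hv)
    have h2 := p.length_dropUntil_le_length hv
    omega

theorem dist_eq_one_of_adj_induce {s : Finset V} {v u : (s : Set V)}
    (h : (T.induce (s : Set V)).Adj v u) : T.dist v.1 u.1 = 1 :=
  dist_eq_one_iff_adj.mpr h

theorem induce_isTree (hT : T.IsTree) {s : Finset V} (hs : (T.induce (s : Set V)).Connected) :
    (T.induce (s : Set V)).IsTree :=
  ⟨hs, hT.isAcyclic.induce _⟩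

variable [Fintype V]

/-- The vertices `x` such that `v` lies on the path from `c` to `x`. -/
noncomputable def desc (T : SimpleGraph V) (c v : V) : Finset V :=
  Finset.univ.filter fun x => T.dist c v + T.dist v x = T.dist c x

theorem mem_desc {c v x : V} : x ∈ desc T c v ↔ T.dist c v + T.dist v x = T.dist c x := by
  simp [desc]

theorem self_mem_desc (c v : V) : v ∈ desc T c v := by
  simp [mem_desc]

variable [DecidableEq V]

theorem image_branchSet_induce (hT : T.IsTree) {s : Finset V}
    (hs : (T.induce (s : Set V)).Connected) {v u : (s : Set V)}
    (h : (T.induce (s : Set V)).Adj v u) :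
    Subtype.val '' branchSet (T.induce (s : Set V)) v u = (desc T v.1 u.1 ∩ s : Finset V) := by
  have h1 := dist_eq_one_of_adj_induce h
  ext x
  simp only [Set.mem_image, Finset.mem_coe, Finset.mem_inter, mem_desc]
  constructor
  · rintro ⟨y, hy, rfl⟩
    rw [mem_branchSet_iff (induce_isTree hT hs) h, dist_induce hT hs, dist_induce hT hs] at hy
    exact ⟨by omega, y.2⟩
  · rintro ⟨hx, hxs⟩
    refine ⟨⟨x, hxs⟩, ?_, rfl⟩
    rw [mem_branchSet_iff (induce_isTree hT hs) h, dist_induce hT hs, dist_induce hT hs]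
    change T.dist v.1 x = T.dist u.1 x + 1
    omega

theorem ncard_branchSet_induce (hT : T.IsTree) {s : Finset V}
    (hs : (T.induce (s : Set V)).Connected) {v u : (s : Set V)}
    (h : (T.induce (s : Set V)).Adj v u) :
    (branchSet (T.induce (s : Set V)) v u).ncard = (desc T v.1 u.1 ∩ s).card := by
  rw [← Set.ncard_image_of_injective _ Subtype.val_injective, image_branchSet_induce hT hs h,
    Set.ncard_coe_finset]

theorem nontrivialBranch_induce_iff (hT : T.IsTree) {s : Finset V}
    (hs : (T.induce (s : Set V)).Connected) {v u : (s : Set V)} :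
    NontrivialBranch (T.induce (s : Set V)) v u ↔
      T.dist v.1 u.1 = 1 ∧ 2 ≤ (desc T v.1 u.1 ∩ s).card := by
  unfold NontrivialBranch
  have key : (T.induce (s : Set V)).Adj v u ↔ T.dist v.1 u.1 = 1 := by
    rw [dist_eq_one_iff_adj]; rfl
  rw [← key]
  refine and_congr_right fun h => ?_
  rw [← ncard_branchSet_induce hT hs h, ← not_iff_not, not_not, not_le]
  have hu : u ∈ branchSet (T.induce (s : Set V)) v u :=
    ⟨Walk.nil, by simpa using h.ne⟩
  constructor
  · intro h'
    simp [h']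
  · intro h'
    rw [Nat.lt_succ_iff, Set.ncard_le_one] at h'
    exact Set.eq_singleton_iff_unique_mem.mpr ⟨hu, fun x hx => h' x hx u hu⟩

/-- The neighbours of `v` through which the branch rooted at `v` meets `s` in at least two
vertices. -/
noncomputable def branchNbrs (T : SimpleGraph V) (s : Finset V) (v : V) : Finset V :=
  Finset.univ.filter fun u => T.dist v u = 1 ∧ 2 ≤ (desc T v u ∩ s).card

theorem mem_branchNbrs {s : Finset V} {v u : V} :
    u ∈ branchNbrs T s v ↔ T.dist v u = 1 ∧ 2 ≤ (desc T v u ∩ s).card := by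
  simp [branchNbrs]

theorem mem_of_desc_inter_nonempty {s : Finset V} (hs : GeodConvex T s) {v u : V} (hv : v ∈ s)
    (h : (desc T v u ∩ s).Nonempty) : u ∈ s := by
  obtain ⟨x, hx⟩ := h
  rw [Finset.mem_inter, mem_desc] at hx
  exact hs hv hx.2 hx.1

theorem ncard_nontrivialBranch_induce (hT : T.IsTree) {s : Finset V}
    (hs : (T.induce (s : Set V)).Connected) (v : (s : Set V)) :
    {u | NontrivialBranch (T.induce (s : Set V)) v u}.ncard = (branchNbrs T s v.1).card := by
  rw [← Set.ncard_image_of_injective _ Subtype.val_injective, ← Set.ncard_coe_finset]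
  congr 1
  ext x
  simp only [Set.mem_image, Set.mem_ofPred_eq, nontrivialBranch_induce_iff hT hs, Finset.mem_coe,
    mem_branchNbrs]
  constructor
  · rintro ⟨y, hy, rfl⟩
    exact hy
  · intro hx
    refine ⟨⟨x, ?_⟩, hx, rfl⟩
    exact mem_of_desc_inter_nonempty (geodConvex_of_connected hT hs) v.2
      (Finset.card_pos.mp (by omega))

/-- The vertex `c` is a center of the subtree of `T` induced by `s`. -/
def IsCenterOn (T : SimpleGraph V) (s : Finset V) (c : V) : Prop :=
  c ∈ s ∧ ∀ u, T.dist c u = 1 → 2 * (desc T c u ∩ s).card ≤ s.card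

theorem isCenter_induce_iff (hT : T.IsTree) {s : Finset V}
    (hs : (T.induce (s : Set V)).Connected) (c : (s : Set V)) :
    IsCenter (T.induce (s : Set V)) c ↔ IsCenterOn T s c.1 := by
  unfold IsCenter IsCenterOn
  have hc : Fintype.card (s : Set V) = s.card := by simp
  constructor
  · refine fun h => ⟨c.2, fun u hu => ?_⟩
    by_cases hus : u ∈ s
    · have hadj : (T.induce (s : Set V)).Adj c ⟨u, hus⟩ := T.dist_eq_one_iff_adj.mp hu
      have := h ⟨u, hus⟩ hadj
      rw [ncard_branchSet_induce hT hs hadj, hc] at this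
      exact this
    · have : desc T c.1 u ∩ s = ∅ := by
        by_contra hne
        exact hus (mem_of_desc_inter_nonempty (geodConvex_of_connected hT hs) c.2
          (Finset.nonempty_iff_ne_empty.mpr hne))
      simp [this]
  · rintro ⟨-, h⟩ u hu
    rw [ncard_branchSet_induce hT hs hu, hc]
    exact h u.1 (dist_eq_one_of_adj_induce hu)

/-- The vertex `w` is a hub of the subtree of `T` induced by `s`, with nearest center `c`. -/
structure IsHubOn (T : SimpleGraph V) (s : Finset V) (c w : V) : Prop where
  mem : w ∈ s
  three : 3 ≤ (branchNbrs T s w).card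
  center : IsCenterOn T s c
  nearest : ∀ c', IsCenterOn T s c' → T.dist w c ≤ T.dist w c'
  only : ∀ v, T.dist w v + T.dist v c = T.dist w c → v ≠ w → (branchNbrs T s v).card ≤ 2

end Induce

section HubAt

variable {W : Type*} [Fintype W]

/-- The vertex `v` is a hub of `G` with nearest center `c`. -/
def IsHubAt (G : SimpleGraph W) (c v : W) : Prop :=
  RootsThreeNontrivial G v ∧ IsCenter G c ∧ (∀ c', IsCenter G c' → G.dist v c ≤ G.dist v c') ∧
    ∀ w, G.dist v w + G.dist w c = G.dist v c → w ≠ v → ¬ RootsThreeNontrivial G w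

/-- The set of distances from hubs of `G` to their nearest centers. -/
def hubDists (G : SimpleGraph W) : Set ℕ :=
  {d | ∃ c v, IsHubAt G c v ∧ G.dist c v = d}

variable {W' : Type*} [Fintype W'] {G : SimpleGraph W} {H : SimpleGraph W'}

theorem dist_hom_le {A B : Type*} {G : SimpleGraph A} {H : SimpleGraph B} (f : G →g H) {x y : A}
    (h : G.Reachable x y) : H.dist (f x) (f y) ≤ G.dist x y := by
  obtain ⟨p, hp⟩ := h.exists_walk_length_eq_dist
  rw [← hp, ← Walk.length_map f]
  exact dist_le _

omit [Fintype W] [Fintype W'] in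
theorem dist_iso_apply (f : G ≃g H) (hG : G.Connected) (x y : W) :
    H.dist (f x) (f y) = G.dist x y := by
  refine le_antisymm (dist_hom_le f.toHom (hG x y)) ?_
  simpa using dist_hom_le f.symm.toHom ((hG x y).map f.toHom)

omit [Fintype W] [Fintype W'] in
theorem map_mem_branchSet (f : G ≃g H) {v u w : W} (hw : w ∈ branchSet G v u) :
    f w ∈ branchSet H (f v) (f u) := by
  obtain ⟨p, hp⟩ := hw
  refine ⟨p.map f.toHom, ?_⟩
  rw [Walk.support_map]
  simpa using hp

omit [Fintype W] [Fintype W'] in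
theorem branchSet_iso (f : G ≃g H) (v u : W) :
    branchSet H (f v) (f u) = f '' branchSet G v u := by
  ext x
  constructor
  · intro hx
    refine ⟨f.symm x, ?_, by simp⟩
    simpa using map_mem_branchSet f.symm hx
  · rintro ⟨y, hy, rfl⟩
    exact map_mem_branchSet f hy

omit [Fintype W] [Fintype W'] in
theorem nontrivialBranch_iso (f : G ≃g H) (v u : W) :
    NontrivialBranch H (f v) (f u) ↔ NontrivialBranch G v u := by
  unfold NontrivialBranch
  rw [branchSet_iso, f.map_adj_iff, ← Set.image_singleton]
  exact and_congr_right fun _ => not_congr (f.injective.image_injective.eq_iff)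

omit [Fintype W] [Fintype W'] in
theorem rootsThreeNontrivial_iso (f : G ≃g H) (v : W) :
    RootsThreeNontrivial H (f v) ↔ RootsThreeNontrivial G v := by
  unfold RootsThreeNontrivial
  have : {u | NontrivialBranch H (f v) u} = f '' {u | NontrivialBranch G v u} := by
    ext x
    constructor
    · intro hx
      refine ⟨f.symm x, ?_, by simp⟩
      change NontrivialBranch G v (f.symm x)
      rw [← nontrivialBranch_iso f]
      simpa using hx
    · rintro ⟨y, hy, rfl⟩
      exact (nontrivialBranch_iso f v y).mpr hy
  rw [this, Set.ncard_image_of_injective _ f.injective]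

theorem isCenter_iso (f : G ≃g H) (v : W) : IsCenter H (f v) ↔ IsCenter G v := by
  unfold IsCenter
  rw [← Fintype.card_congr f.toEquiv]
  constructor
  · intro h u hu
    have := h (f u) (f.map_adj_iff.mpr hu)
    rwa [branchSet_iso, Set.ncard_image_of_injective _ f.injective] at this
  · intro h u hu
    obtain ⟨u, rfl⟩ := f.surjective u
    rw [branchSet_iso, Set.ncard_image_of_injective _ f.injective]
    exact h u (f.map_adj_iff.mp hu)

theorem hubDists_subset_of_iso (f : G ≃g H) (hG : G.Connected) : hubDists G ⊆ hubDists H := by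
  rintro d ⟨c, v, ⟨h1, h2, h3, h4⟩, rfl⟩
  refine ⟨f c, f v, ⟨(rootsThreeNontrivial_iso f v).mpr h1, (isCenter_iso f c).mpr h2, ?_, ?_⟩,
    dist_iso_apply f hG c v⟩
  · intro c' hc'
    obtain ⟨c', rfl⟩ := f.surjective c'
    rw [dist_iso_apply f hG, dist_iso_apply f hG]
    exact h3 c' ((isCenter_iso f c').mp hc')
  · intro w hw hne
    obtain ⟨w, rfl⟩ := f.surjective w
    rw [dist_iso_apply f hG, dist_iso_apply f hG, dist_iso_apply f hG] at hw
    rw [rootsThreeNontrivial_iso]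
    exact h4 w hw fun h => hne (h ▸ rfl)

theorem hubDists_iso (f : G ≃g H) (hG : G.Connected) : hubDists G = hubDists H :=
  (hubDists_subset_of_iso f hG).antisymm
    (hubDists_subset_of_iso f.symm (f.connected_iff.mp hG))

end HubAt

section

variable {V : Type*} {T : SimpleGraph V} [Fintype V] [DecidableEq V]

theorem isHubAt_induce_iff (hT : T.IsTree) {s : Finset V}
    (hs : (T.induce (s : Set V)).Connected) (c w : (s : Set V)) :
    IsHubAt (T.induce (s : Set V)) c w ↔ IsHubOn T s c.1 w.1 := by
  unfold IsHubAt RootsThreeNontrivial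
  simp only [isCenter_induce_iff hT hs, dist_induce hT hs, ncard_nontrivialBranch_induce hT hs]
  constructor
  · rintro ⟨h1, h2, h3, h4⟩
    refine ⟨w.2, h1, h2, fun c' hc' => h3 ⟨c', hc'.1⟩ hc', fun v hv hne => ?_⟩
    have := h4 ⟨v, geodConvex_of_connected hT hs w.2 c.2 hv⟩ hv
      fun h => hne (congrArg Subtype.val h)
    change ¬ 3 ≤ (branchNbrs T s v).card at this
    omega
  · rintro ⟨-, h1, h2, h3, h4⟩
    refine ⟨h1, h2, fun c' hc' => h3 c'.1 hc', fun v hv hne => ?_⟩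
    have := h4 v.1 hv fun h => hne (Subtype.ext h)
    omega

theorem isHub_induce_iff (hT : T.IsTree) {s : Finset V}
    (hs : (T.induce (s : Set V)).Connected) (w : (s : Set V)) :
    IsHub (T.induce (s : Set V)) w ↔ ∃ c, IsHubOn T s c w.1 := by
  constructor
  · rintro ⟨h1, c, h2⟩
    exact ⟨c.1, (isHubAt_induce_iff hT hs c w).mp ⟨h1, h2⟩⟩
  · rintro ⟨c, h⟩
    obtain ⟨h1, h2⟩ := (isHubAt_induce_iff hT hs ⟨c, h.center.1⟩ w).mpr h
    exact ⟨h1, ⟨c, h.center.1⟩, h2⟩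

theorem mem_hubDists_induce_iff (hT : T.IsTree) {s : Finset V}
    (hs : (T.induce (s : Set V)).Connected) (d : ℕ) :
    d ∈ hubDists (T.induce (s : Set V)) ↔ ∃ c w, IsHubOn T s c w ∧ T.dist c w = d := by
  constructor
  · rintro ⟨c, w, h, rfl⟩
    exact ⟨c.1, w.1, (isHubAt_induce_iff hT hs c w).mp h, (dist_induce hT hs c w).symm⟩
  · rintro ⟨c, w, h, rfl⟩
    exact ⟨⟨c, h.center.1⟩, ⟨w, h.mem⟩, (isHubAt_induce_iff hT hs ⟨c, h.center.1⟩ ⟨w, h.mem⟩).mpr h,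
      dist_induce hT hs _ _⟩

end

section Budget

variable {V : Type*} [DecidableEq V]

/-- The vertices reachable from `v` by `d` steps from a vertex to one of its `kids`, where
leaving a vertex with `m` kids costs `m - 1` and the total cost is at most `j`. -/
def budgetReach (kids : V → Finset V) : ℕ → ℕ → V → Finset V
  | 0, _, v => {v}
  | d + 1, j, v =>
    if (kids v).card - 1 ≤ j then
      (kids v).biUnion (budgetReach kids d (j - ((kids v).card - 1)))
    else ∅

variable {kids : V → Finset V}

theorem mem_budgetReach_succ {d j : ℕ} {v w : V} :
    w ∈ budgetReach kids (d + 1) j v ↔ (kids v).card - 1 ≤ j ∧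
      ∃ u ∈ kids v, w ∈ budgetReach kids d (j - ((kids v).card - 1)) u := by
  rw [budgetReach]
  split_ifs with h <;> simp [h]

theorem budgetReach_mono {d : ℕ} : ∀ {j j' : ℕ} {v : V}, j ≤ j' →
    budgetReach kids d j v ⊆ budgetReach kids d j' v := by
  induction d with
  | zero => intro j j' v _; simp [budgetReach]
  | succ d ih =>
    intro j j' v h w
    rw [mem_budgetReach_succ, mem_budgetReach_succ]
    rintro ⟨h1, u, hu, hw⟩
    exact ⟨h1.trans h, u, hu, ih (by omega) hw⟩

theorem card_budgetReach_le {d : ℕ} : ∀ (j : ℕ) (v : V),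
    (budgetReach kids d j v).card ≤ 2 ^ j := by
  induction d with
  | zero => intro j v; simpa [budgetReach] using Nat.one_le_two_pow
  | succ d ih =>
    intro j v
    rw [budgetReach]
    split_ifs with h
    · refine (Finset.card_biUnion_le_card_mul _ _ _ fun u _ => ih _ u).trans ?_
      rcases Nat.eq_zero_or_pos (kids v).card with h0 | h0
      · simp [h0]
      · have h1 : (kids v).card ≤ 2 ^ ((kids v).card - 1) := by
          have := Nat.lt_two_pow_self (n := (kids v).card - 1)
          omega
        calc _ ≤ 2 ^ ((kids v).card - 1) * 2 ^ (j - ((kids v).card - 1)) :=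
              Nat.mul_le_mul_right _ h1
          _ = 2 ^ j := by rw [← pow_add]; congr 1; omega
    · simp

theorem card_budgetReach_le_one {d : ℕ} : ∀ (j : ℕ) (v : V),
    (budgetReach kids d 0 v).Nonempty → (budgetReach kids d j v).card ≤ 1 := by
  induction d with
  | zero => intro j v _; simp [budgetReach]
  | succ d ih =>
    rintro j v ⟨w, hw⟩
    rw [mem_budgetReach_succ] at hw
    obtain ⟨h1, u, hu, hw⟩ := hw
    have h2 : kids v = {u} := by
      refine (Finset.eq_of_subset_of_card_le (Finset.singleton_subset_iff.mpr hu) ?_).symm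
      simp; omega
    rw [budgetReach, h2]
    simp only [Finset.card_singleton, Nat.sub_self, Nat.zero_le, if_true, Nat.sub_zero,
      Finset.singleton_biUnion]
    exact ih j u ⟨w, by simpa [h2] using hw⟩

theorem budgetReach_nonempty_of_succ {d : ℕ} : ∀ {j : ℕ} {v : V},
    (budgetReach kids (d + 1) j v).Nonempty → (budgetReach kids d j v).Nonempty := by
  induction d with
  | zero => intro j v _; simp [budgetReach]
  | succ d ih =>
    rintro j v ⟨w, hw⟩
    rw [mem_budgetReach_succ] at hw
    obtain ⟨h1, u, hu, hw⟩ := hw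
    obtain ⟨x, hx⟩ := ih ⟨w, hw⟩
    exact ⟨x, mem_budgetReach_succ.mpr ⟨h1, u, hu, hx⟩⟩

theorem budgetReach_nonempty_of_le {d d' j : ℕ} {v : V} (h : d ≤ d')
    (hne : (budgetReach kids d' j v).Nonempty) : (budgetReach kids d j v).Nonempty := by
  induction d', h using Nat.le_induction with
  | base => exact hne
  | succ d' _ ih => exact ih (budgetReach_nonempty_of_succ hne)

/-- Two sets of vertices reached from `A` and `B` respectively, such that each of their elements
can be reached while leaving enough of a total budget of three to reach something from the other
side, together have at most nine elements. -/
theorem card_add_card_le_nine {a b : ℕ} {A B : V} {X Y : Finset V}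
    (hX : ∀ w ∈ X, ∃ i j, i + j ≤ 3 ∧ w ∈ budgetReach kids a i A ∧
      (budgetReach kids b j B).Nonempty)
    (hY : ∀ w ∈ Y, ∃ i j, i + j ≤ 3 ∧ (budgetReach kids a i A).Nonempty ∧
      w ∈ budgetReach kids b j B) :
    X.card + Y.card ≤ 9 := by
  have sub : ∀ {n : ℕ} {d : ℕ} {v : V} {Z : Finset V},
      (∀ w ∈ Z, ∃ i ≤ n, w ∈ budgetReach kids d i v) → Z ⊆ budgetReach kids d n v := by
    intro n d v Z h w hw
    obtain ⟨i, hi, hw⟩ := h w hw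
    exact budgetReach_mono hi hw
  have hX3 : X ⊆ budgetReach kids a 3 A := sub fun w hw => by
    obtain ⟨i, j, h, h', -⟩ := hX w hw
    exact ⟨i, by omega, h'⟩
  have hY3 : Y ⊆ budgetReach kids b 3 B := sub fun w hw => by
    obtain ⟨i, j, h, -, h'⟩ := hY w hw
    exact ⟨j, by omega, h'⟩
  by_cases hA : (budgetReach kids a 0 A).Nonempty
  · have h1 := (Finset.card_le_card hX3).trans (card_budgetReach_le_one 3 A hA)
    have h2 := (Finset.card_le_card hY3).trans (card_budgetReach_le 3 B)
    omega
  by_cases hB : (budgetReach kids b 0 B).Nonempty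
  · have h1 := (Finset.card_le_card hY3).trans (card_budgetReach_le_one 3 B hB)
    have h2 := (Finset.card_le_card hX3).trans (card_budgetReach_le 3 A)
    omega
  have hX2 : X ⊆ budgetReach kids a 2 A := sub fun w hw => by
    obtain ⟨i, j, h, h', h''⟩ := hX w hw
    refine ⟨i, ?_, h'⟩
    rcases Nat.eq_zero_or_pos j with rfl | hj
    · exact absurd h'' hB
    · omega
  have hY2 : Y ⊆ budgetReach kids b 2 B := sub fun w hw => by
    obtain ⟨i, j, h, h', h''⟩ := hY w hw
    refine ⟨j, ?_, h''⟩
    rcases Nat.eq_zero_or_pos i with rfl | hj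
    · exact absurd h' hA
    · omega
  have h1 := (Finset.card_le_card hX2).trans (card_budgetReach_le 2 A)
  have h2 := (Finset.card_le_card hY2).trans (card_budgetReach_le 2 B)
  omega

end Budget

section Rooted

variable {V : Type*} {T : SimpleGraph V} [Fintype V]

theorem desc_subset (hT : T.IsTree) {c v u : V} (h : u ∈ desc T c v) :
    desc T c u ⊆ desc T c v := by
  intro x hx
  rw [mem_desc] at *
  have h1 := hT.connected.dist_triangle (u := v) (v := u) (w := x)
  have h2 := hT.connected.dist_triangle (u := c) (v := v) (w := x)
  omega

theorem desc_disjoint (hT : T.IsTree) {c u u' : V} (h : T.dist c u = T.dist c u') (hne : u ≠ u') :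
    Disjoint (desc T c u) (desc T c u') := by
  rw [Finset.disjoint_left]
  intro x hx hx'
  rw [mem_desc] at hx hx'
  exact hne (hT.between_unique hx hx' h)

theorem mem_desc_of_child {c v u : V} (h1 : T.dist v u = 1)
    (h2 : T.dist c u = T.dist c v + 1) : u ∈ desc T c v := by
  rw [mem_desc]; omega

theorem desc_eq_of_child (hT : T.IsTree) {c v u : V} (h1 : T.dist v u = 1)
    (h2 : T.dist c u = T.dist c v + 1) : desc T v u = desc T c u := by
  ext x
  rw [mem_desc, mem_desc]
  constructor
  · intro hx
    have c1 := T.dist_comm (u := u) (v := c)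
    have c2 := T.dist_comm (u := v) (v := c)
    have := hT.dist_across' (y := c) (x := x) h1 (by omega) (by omega)
    omega
  · intro hx
    have := hT.connected.dist_triangle (u := c) (v := v) (w := x)
    rcases hT.dist_step h1 x with h | h <;> omega

theorem desc_eq_compl_of_parent (hT : T.IsTree) [DecidableEq V] {c v p : V} (h1 : T.dist v p = 1)
    (h2 : T.dist c v = T.dist c p + 1) : desc T v p = (desc T c v)ᶜ := by
  ext x
  rw [Finset.mem_compl, mem_desc, mem_desc]
  have c1 := T.dist_comm (u := v) (v := c)
  have c2 := T.dist_comm (u := p) (v := c)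
  have c3 := T.dist_comm (u := p) (v := v)
  constructor
  · intro hx hx'
    have := hT.connected.dist_triangle (u := c) (v := p) (w := x)
    omega
  · intro hx
    rcases hT.dist_step h1 x with h | h
    · omega
    · have := hT.dist_across' (v := p) (u := v) (y := c) (x := x) (by omega) (by omega) h
      omega

variable [DecidableEq V]

/-- The children of `v`, when `T` is rooted at `c`, that have at least two descendants in `s`
(each vertex being a descendant of itself). -/
noncomputable def bigKids (T : SimpleGraph V) (s : Finset V) (c v : V) : Finset V :=
  Finset.univ.filter fun u =>
    T.dist v u = 1 ∧ T.dist c u = T.dist c v + 1 ∧ 2 ≤ (desc T c u ∩ s).card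

theorem mem_bigKids {s : Finset V} {c v u : V} : u ∈ bigKids T s c v ↔
    T.dist v u = 1 ∧ T.dist c u = T.dist c v + 1 ∧ 2 ≤ (desc T c u ∩ s).card := by
  simp [bigKids]

theorem bigKids_subset_branchNbrs (hT : T.IsTree) (s : Finset V) (c v : V) :
    bigKids T s c v ⊆ branchNbrs T s v := by
  intro u hu
  rw [mem_bigKids] at hu
  rw [mem_branchNbrs, desc_eq_of_child hT hu.1 hu.2.1]
  exact ⟨hu.1, hu.2.2⟩

theorem card_desc_inter_le_of_center (hT : T.IsTree) {s : Finset V} {c v : V}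
    (hc : IsCenterOn T s c) (hv : v ≠ c) : 2 * (desc T c v ∩ s).card ≤ s.card := by
  obtain ⟨a, ha1, ha2⟩ := hT.connected.exists_hop hv.symm
  refine le_trans ?_ (hc.2 a ha1)
  gcongr
  exact desc_subset hT (mem_desc.mpr (by omega))

theorem card_bigKids_lt_card_branchNbrs (hT : T.IsTree) {s : Finset V} {c v : V}
    (hc : IsCenterOn T s c) (hv : v ≠ c) (hs : 4 ≤ s.card) :
    (bigKids T s c v).card < (branchNbrs T s v).card := by
  obtain ⟨p, hp1, hp2⟩ := hT.connected.exists_hop hv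
  have c1 := T.dist_comm (u := v) (v := c)
  have c2 := T.dist_comm (u := p) (v := c)
  refine Finset.card_lt_card ((Finset.ssubset_iff_of_subset
    (bigKids_subset_branchNbrs hT s c v)).mpr ⟨p, ?_, ?_⟩)
  · rw [mem_branchNbrs, desc_eq_compl_of_parent hT (c := c) hp1 (by omega)]
    refine ⟨hp1, ?_⟩
    have h1 := card_desc_inter_le_of_center hT hc hv
    have h2 : ((desc T c v)ᶜ ∩ s).card + (desc T c v ∩ s).card = s.card := by
      rw [← Finset.card_union_of_disjoint]
      · rw [← Finset.union_inter_distrib_right, Finset.union_comm, Finset.union_compl,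
          Finset.univ_inter]
      · exact Finset.disjoint_left.mpr fun x hx hx' => by
          simp only [Finset.mem_inter, Finset.mem_compl] at hx hx'
          exact hx.1 hx'.1
    omega
  · rw [mem_bigKids]
    omega

theorem card_branchNbrs_le (hT : T.IsTree) (s : Finset V) (c v : V) :
    (branchNbrs T s v).card ≤ (bigKids T s c v).card + 1 := by
  have h : (branchNbrs T s v \ bigKids T s c v).card ≤ 1 := by
    rw [Finset.card_le_one]
    have key : ∀ u ∈ branchNbrs T s v \ bigKids T s c v,
        T.dist v u = 1 ∧ T.dist u c + 1 = T.dist v c := by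
      intro u hu
      rw [Finset.mem_sdiff, mem_branchNbrs, mem_bigKids] at hu
      obtain ⟨⟨h1, h2⟩, h3⟩ := hu
      refine ⟨h1, ?_⟩
      rcases hT.dist_step h1 c with h | h
      · exact h.symm
      · have c1 := T.dist_comm (u := v) (v := c)
        have c2 := T.dist_comm (u := u) (v := c)
        rw [desc_eq_of_child hT (c := c) h1 (by omega)] at h2
        exact absurd ⟨h1, by omega, h2⟩ h3
    intro u hu u' hu'
    obtain ⟨h1, h2⟩ := key u hu
    obtain ⟨h1', h2'⟩ := key u' hu'
    exact hT.between_unique (x := v) (y := c) (by omega) (by omega) (by omega)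
  have := Finset.card_le_card_sdiff_add_card (s := branchNbrs T s v) (t := bigKids T s c v)
  omega

theorem sum_card_inter_desc_le (hT : T.IsTree) (E K : Finset V) {c v : V} {m : ℕ}
    (hK : ∀ u ∈ K, u ∈ desc T c v ∧ T.dist c u = m) :
    ∑ u ∈ K, (desc T c u ∩ E).card ≤ (desc T c v ∩ E).card := by
  rw [← Finset.card_biUnion]
  · refine Finset.card_le_card (Finset.biUnion_subset.mpr fun u hu => ?_)
    exact Finset.inter_subset_inter_right (desc_subset hT (hK u hu).1)
  · intro u hu u' hu' hne
    refine Finset.disjoint_of_subset_left Finset.inter_subset_left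
      (Finset.disjoint_of_subset_right Finset.inter_subset_left ?_)
    exact desc_disjoint hT (by rw [(hK u hu).2, (hK u' hu').2]) hne

theorem bigKids_level {s : Finset V} {c v u : V} (hu : u ∈ bigKids T s c v) :
    u ∈ desc T c v ∧ T.dist c u = T.dist c v + 1 := by
  rw [mem_bigKids] at hu
  exact ⟨mem_desc_of_child hu.1 hu.2.1, hu.2.1⟩

theorem five_le_card_desc_inter (hT : T.IsTree) {s : Finset V} {c w : V} (hw : w ∈ s)
    (h : 3 ≤ (branchNbrs T s w).card) : 5 ≤ (desc T c w ∩ s).card := by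
  have h1 := card_branchNbrs_le hT s c w
  have h2 := sum_card_inter_desc_le hT (s.erase w) (bigKids T s c w)
    (fun u hu => bigKids_level (c := c) hu)
  have h3 : ∑ u ∈ bigKids T s c w, 2 ≤
      ∑ u ∈ bigKids T s c w, (desc T c u ∩ s.erase w).card := by
    refine Finset.sum_le_sum fun u hu => ?_
    rw [mem_bigKids] at hu
    rw [Finset.inter_erase, Finset.erase_eq_of_notMem]
    · exact hu.2.2
    · rw [Finset.mem_inter, mem_desc]
      omega
  have h4 : (desc T c w ∩ s.erase w).card + 1 = (desc T c w ∩ s).card := by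
    rw [Finset.inter_erase]
    exact Finset.card_erase_add_one (Finset.mem_inter.mpr ⟨self_mem_desc c w, hw⟩)
  rw [Finset.sum_const, smul_eq_mul] at h3
  omega

theorem one_le_card_desc_inter_sdiff {s₀ s : Finset V} {c v u : V}
    (h : u ∈ bigKids T s₀ c v \ bigKids T s c v) : 1 ≤ (desc T c u ∩ (s₀ \ s)).card := by
  rw [Finset.mem_sdiff, mem_bigKids, mem_bigKids] at h
  have h1 : (desc T c u ∩ s).card < 2 := by
    by_contra h'
    exact h.2 ⟨h.1.1, h.1.2.1, by omega⟩
  have h2 : desc T c u ∩ s₀ ⊆ desc T c u ∩ (s₀ \ s) ∪ desc T c u ∩ s := by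
    intro x
    simp only [Finset.mem_inter, Finset.mem_union, Finset.mem_sdiff]
    tauto
  have h3 := (Finset.card_le_card h2).trans (Finset.card_union_le _ _)
  omega

theorem card_add_card_sdiff_le (hT : T.IsTree) {s₀ s K : Finset V} {c v : V}
    (hK : K ⊆ bigKids T s₀ c v ∩ bigKids T s c v) :
    ∑ u ∈ K, (desc T c u ∩ (s₀ \ s)).card + (bigKids T s₀ c v \ bigKids T s c v).card ≤
      (desc T c v ∩ (s₀ \ s)).card := by
  have h := sum_card_inter_desc_le hT (s₀ \ s) (bigKids T s₀ c v)
    (fun u hu => bigKids_level (c := c) hu)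
  refine le_trans ?_ h
  rw [← Finset.sum_sdiff (Finset.sdiff_subset (s := bigKids T s₀ c v) (t := bigKids T s c v)),
    Finset.sdiff_sdiff_self_left]
  refine Nat.add_le_add (Finset.sum_le_sum_of_subset hK) ?_
  rw [Finset.card_eq_sum_ones]
  exact Finset.sum_le_sum fun u hu => one_le_card_desc_inter_sdiff hu

theorem mem_budgetReach_of_path (hT : T.IsTree) {s₀ s : Finset V} {c w : V}
    (h₀ : 2 ≤ (desc T c w ∩ s₀).card) (h : 2 ≤ (desc T c w ∩ s).card) :
    ∀ (d : ℕ) (v : V), w ∈ desc T c v → T.dist v w = d →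
      (∀ x ∈ desc T c v, w ∈ desc T c x → x ≠ w → (bigKids T s c x).card ≤ 1) →
      w ∈ budgetReach (bigKids T s₀ c) d (desc T c v ∩ (s₀ \ s)).card v := by
  intro d
  induction d with
  | zero =>
    intro v _ hd _
    rw [hT.connected.dist_eq_zero_iff] at hd
    simp [budgetReach, hd]
  | succ d ih =>
    intro v hv hd hx
    have hne : v ≠ w := by rintro rfl; simp at hd
    obtain ⟨u, hu1, hu2⟩ := hT.connected.exists_hop hne
    rw [mem_desc] at hv
    have t1 := hT.connected.dist_triangle (u := c) (v := u) (w := w)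
    have t2 := hT.connected.dist_triangle (u := c) (v := v) (w := u)
    have hcu : T.dist c u = T.dist c v + 1 := by omega
    have hwu : w ∈ desc T c u := mem_desc.mpr (by omega)
    have huv := mem_desc_of_child hu1 hcu
    have hsub := desc_subset hT hwu
    have hk₀ : u ∈ bigKids T s₀ c v := mem_bigKids.mpr ⟨hu1, hcu,
      h₀.trans (Finset.card_le_card (Finset.inter_subset_inter_right hsub))⟩
    have hk : u ∈ bigKids T s c v := mem_bigKids.mpr ⟨hu1, hcu,
      h.trans (Finset.card_le_card (Finset.inter_subset_inter_right hsub))⟩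
    have h1 := card_add_card_sdiff_le hT (s₀ := s₀) (s := s) (c := c) (v := v) (K := {u})
      (by simp [hk₀, hk])
    rw [Finset.sum_singleton] at h1
    have h2 := hx v (self_mem_desc c v) (mem_desc.mpr hv) hne
    have h3 := Finset.card_le_card_sdiff_add_card (s := bigKids T s₀ c v) (t := bigKids T s c v)
    refine mem_budgetReach_succ.mpr ⟨by omega, u, hk₀, ?_⟩
    refine budgetReach_mono (by omega) (ih u hwu (by omega) fun x hxu => ?_)
    exact hx x (desc_subset hT huv hxu)

end Rooted

section Center

variable {V : Type*} {T : SimpleGraph V}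

theorem dist_add_dist_of_between (hT : T.IsTree) {p q a x : V}
    (ha : T.dist p a + T.dist a q = T.dist p q) (hx : T.dist p x + T.dist x q = T.dist p q)
    (h : T.dist p a ≤ T.dist p x) : T.dist p a + T.dist a x = T.dist p x := by
  obtain ⟨b, hb1, hb2⟩ := hT.connected.exists_between h
  have t1 := hT.connected.dist_triangle (u := b) (v := x) (w := q)
  have t2 := hT.connected.dist_triangle (u := p) (v := b) (w := q)
  have : b = a := hT.between_unique (x := p) (y := q) (by omega) ha hb1
  subst this
  omega

variable [Fintype V] [DecidableEq V]

omit [DecidableEq V] in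
theorem mem_desc_or_mem_desc (hT : T.IsTree) {p q a b : V} (ha : T.dist p a = 1)
    (haq : T.dist p a + T.dist a q = T.dist p q) (hbp : T.dist q b + T.dist b p = T.dist q p)
    (x : V) : x ∈ desc T p a ∨ x ∈ desc T q b := by
  rw [mem_desc, mem_desc]
  rcases hT.dist_step ha x with h | h
  · left; omega
  · right
    have c1 := T.dist_comm (u := a) (v := p)
    have c2 := T.dist_comm (u := q) (v := a)
    have c3 := T.dist_comm (u := q) (v := p)
    have h1 := hT.dist_across' (v := a) (u := p) (y := q) (x := x) (by omega) (by omega) h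
    have t1 := hT.connected.dist_triangle (u := b) (v := p) (w := x)
    have t2 := hT.connected.dist_triangle (u := q) (v := b) (w := x)
    omega

theorem card_add_dist_le (hT : T.IsTree) {s : Finset V} (hs : GeodConvex T s) {p q a b : V}
    (hp : p ∈ s) (hq : q ∈ s) (ha : T.dist p a = 1) (hb : T.dist q b = 1)
    (haq : T.dist p a + T.dist a q = T.dist p q) (hbp : T.dist q b + T.dist b p = T.dist q p) :
    s.card + (T.dist p q - 1) ≤ (desc T p a ∩ s).card + (desc T q b ∩ s).card := by
  rw [← Finset.card_union_add_card_inter]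
  refine Nat.add_le_add (Finset.card_le_card fun x hx => ?_) ?_
  · rw [Finset.mem_union, Finset.mem_inter, Finset.mem_inter]
    rcases mem_desc_or_mem_desc hT ha haq hbp x with h | h
    · exact Or.inl ⟨h, hx⟩
    · exact Or.inr ⟨h, hx⟩
  · have hf : ∀ k : ℕ, ∃ x, k ≤ T.dist p q → T.dist p x = k ∧ T.dist x q = T.dist p q - k := by
      intro k
      by_cases hk : k ≤ T.dist p q
      · obtain ⟨x, hx⟩ := hT.connected.exists_between hk
        exact ⟨x, fun _ => hx⟩
      · exact ⟨p, fun h => absurd h hk⟩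
    choose f hf using hf
    have hcard : ((Finset.Icc 1 (T.dist p q - 1)).image f).card = T.dist p q - 1 := by
      rw [Finset.card_image_of_injOn, Nat.card_Icc, Nat.add_sub_cancel]
      intro k hk l hl hkl
      rw [Finset.mem_coe, Finset.mem_Icc] at hk hl
      have h1 := (hf k (by omega)).1
      have h2 := (hf l (by omega)).1
      rw [hkl] at h1
      omega
    rw [← hcard]
    refine Finset.card_le_card (Finset.image_subset_iff.mpr fun k hk => ?_)
    rw [Finset.mem_Icc] at hk
    obtain ⟨h1, h2⟩ := hf k (by omega)
    have c1 := T.dist_comm (u := q) (v := p)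
    have c2 := T.dist_comm (u := q) (v := f k)
    have c3 := T.dist_comm (u := p) (v := f k)
    have hm : f k ∈ s := hs hp hq (by omega)
    simp only [Finset.mem_inter, mem_desc, hm, and_true]
    exact ⟨dist_add_dist_of_between hT haq (by omega) (by omega),
      dist_add_dist_of_between hT hbp (by omega) (by omega)⟩

theorem IsCenterOn.dist_le_one (hT : T.IsTree) {s : Finset V} (hs : GeodConvex T s) {p q : V}
    (hp : IsCenterOn T s p) (hq : IsCenterOn T s q) : T.dist p q ≤ 1 := by
  by_cases h : p = q
  · simp [h]
  obtain ⟨a, ha1, ha2⟩ := hT.connected.exists_hop h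
  obtain ⟨b, hb1, hb2⟩ := hT.connected.exists_hop (Ne.symm h)
  have h1 := card_add_dist_le hT hs hp.1 hq.1 ha1 hb1 (by omega) (by omega)
  have h2 := hp.2 a ha1
  have h3 := hq.2 b hb1
  omega

omit [DecidableEq V] in
theorem subset_desc_of_notMem (hT : T.IsTree) {I : Finset V} (hI : GeodConvex T I) {c a x : V}
    (hc : c ∉ I) (hx : x ∈ I) (ha : T.dist c a = 1) (hax : T.dist c x = T.dist a x + 1) :
    I ⊆ desc T c a := by
  intro y hy
  rw [mem_desc]
  rcases hT.dist_step ha y with h | h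
  · omega
  · have c1 := T.dist_comm (u := a) (v := c)
    have c2 := T.dist_comm (u := x) (v := c)
    have c3 := T.dist_comm (u := x) (v := a)
    have h1 := hT.dist_across' (v := a) (u := c) (y := x) (x := y) (by omega) hax h
    exact absurd (hI hx hy (by omega)) hc

/-- `s` is the vertex set of a subtree of `T` obtained from the subtree with vertex set `s₀` by
moving at most three edges. -/
structure IsMove (T : SimpleGraph V) (s₀ s : Finset V) : Prop where
  convex : GeodConvex T s
  convex_inter : GeodConvex T (s₀ ∩ s)
  card_eq : s.card = s₀.card
  card_le : s₀.card ≤ (s₀ ∩ s).card + 3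

variable {s₀ s : Finset V}

omit [Fintype V] in
theorem IsMove.card_sdiff_le (h : IsMove T s₀ s) : (s₀ \ s).card ≤ 3 := by
  have h1 := Finset.card_sdiff_add_card_inter s₀ s
  have h2 := h.card_le
  omega

omit [Fintype V] in
theorem IsMove.card_sdiff_le' (h : IsMove T s₀ s) : (s \ s₀).card ≤ 3 := by
  have h1 := Finset.card_sdiff_add_card_inter s s₀
  have h2 := h.card_le
  have h3 := h.card_eq
  rw [Finset.inter_comm] at h2
  omega

omit [Fintype V] in
theorem card_inter_le_add_card_sdiff (D s t : Finset V) :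
    (D ∩ s).card ≤ (D ∩ t).card + (s \ t).card := by
  refine le_trans (Finset.card_le_card fun x => ?_) (Finset.card_union_le _ _)
  simp only [Finset.mem_inter, Finset.mem_union, Finset.mem_sdiff]
  tauto

theorem IsMove.center_mem (hT : T.IsTree) (h : IsMove T s₀ s) (hn : 7 ≤ s₀.card) {c : V}
    (hc : IsCenterOn T s c) : c ∈ s₀ := by
  by_contra hcs
  have hcI : c ∉ s₀ ∩ s := fun h' => hcs (Finset.mem_inter.mp h').1
  have h1 := h.card_le
  have h2 := h.card_eq
  obtain ⟨x, hx⟩ : (s₀ ∩ s).Nonempty := by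
    rw [← Finset.card_pos]; omega
  have hcx : c ≠ x := by rintro rfl; exact hcI hx
  obtain ⟨a, ha1, ha2⟩ := hT.connected.exists_hop hcx
  have h3 := subset_desc_of_notMem hT h.convex_inter hcI hx ha1 ha2
  have h4 := Finset.card_le_card (Finset.subset_inter h3 Finset.inter_subset_right)
  have h5 := hc.2 a ha1
  omega

/-- The vertex `w` roots at least three non-trivial branches of `T` restricted to `s`, and no
vertex strictly between `c` and `w` does. -/
structure VisibleFrom (T : SimpleGraph V) (s : Finset V) (c w : V) : Prop where
  mem : w ∈ s
  three : 3 ≤ (branchNbrs T s w).card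
  ne : w ≠ c
  only : ∀ v, w ∈ desc T c v → v ≠ c → v ≠ w → (branchNbrs T s v).card ≤ 2

variable {c w : V}

theorem VisibleFrom.card_bigKids_le (hT : T.IsTree) (hc : IsCenterOn T s c) (hs : 4 ≤ s.card)
    (hw : VisibleFrom T s c w) {v : V} (h : w ∈ desc T c v) (h1 : v ≠ c) (h2 : v ≠ w) :
    (bigKids T s c v).card ≤ 1 := by
  have := card_bigKids_lt_card_branchNbrs hT hc h1 hs
  have := hw.only v h h1 h2
  omega

theorem VisibleFrom.five_le (hT : T.IsTree) (hw : VisibleFrom T s c w) {v : V}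
    (h : w ∈ desc T c v) : 5 ≤ (desc T c v ∩ s).card :=
  (five_le_card_desc_inter hT hw.mem hw.three).trans
    (Finset.card_le_card (Finset.inter_subset_inter_right (desc_subset hT h)))

theorem exists_bigKid_of_mem_desc (hT : T.IsTree) {v : V} (h : w ∈ desc T c v)
    (hne : v ≠ w) (hs : 2 ≤ (desc T c w ∩ s).card) :
    ∃ u ∈ bigKids T s c v, w ∈ desc T c u ∧ T.dist v w = T.dist u w + 1 := by
  obtain ⟨u, hu1, hu2⟩ := hT.connected.exists_hop hne
  rw [mem_desc] at h
  have t1 := hT.connected.dist_triangle (u := c) (v := u) (w := w)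
  have t2 := hT.connected.dist_triangle (u := c) (v := v) (w := u)
  have hwu : w ∈ desc T c u := mem_desc.mpr (by omega)
  exact ⟨u, mem_bigKids.mpr ⟨hu1, by omega,
    hs.trans (Finset.card_le_card (Finset.inter_subset_inter_right (desc_subset hT hwu)))⟩,
    hwu, hu2⟩

theorem VisibleFrom.eq_of_mem_desc (hT : T.IsTree) (hc : IsCenterOn T s c) (hs : 4 ≤ s.card)
    {w' : V} (hw : VisibleFrom T s c w) (hw' : VisibleFrom T s c w') :
    ∀ (d : ℕ) (v : V), T.dist v w = d → v ≠ c → w ∈ desc T c v → w' ∈ desc T c v → w = w' := by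
  have two {x : V} (hx : VisibleFrom T s c x) : 2 ≤ (desc T c x ∩ s).card :=
    le_trans (by norm_num) (hx.five_le hT (self_mem_desc c x))
  intro d
  induction d with
  | zero =>
    intro v hd hv _ h'
    rw [hT.connected.dist_eq_zero_iff] at hd
    subst hd
    by_contra hne
    have := hw'.only v h' hv hne
    have := hw.three
    omega
  | succ d ih =>
    intro v hd hv h h'
    have h1 : v ≠ w := by rintro rfl; simp at hd
    by_cases h2 : v = w'
    · subst h2
      have := hw.only v h hv h1
      have := hw'.three
      omega
    obtain ⟨u, hu, hwu, hdu⟩ := exists_bigKid_of_mem_desc hT h h1 (two hw)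
    obtain ⟨u', hu', hwu', -⟩ := exists_bigKid_of_mem_desc hT h' h2 (two hw')
    have := Finset.card_le_one.mp (hw.card_bigKids_le hT hc hs h hv h1) u hu u' hu'
    subst this
    refine ih u (by omega) ?_ hwu hwu'
    rintro rfl
    have := (mem_bigKids.mp hu).2.1
    simp at this

theorem IsHubOn.visibleFrom (hT : T.IsTree) (hs : GeodConvex T s) {c₁ : V}
    (hw : IsHubOn T s c₁ w) (hc : IsCenterOn T s c) (hne : w ≠ c) : VisibleFrom T s c w := by
  refine ⟨hw.mem, hw.three, hne, fun v hv hvc hvw => hw.only v ?_ hvw⟩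
  rw [mem_desc] at hv
  have c1 := T.dist_comm (u := w) (v := v)
  have c2 := T.dist_comm (u := w) (v := c₁)
  have c3 := T.dist_comm (u := w) (v := c)
  have c4 := T.dist_comm (u := v) (v := c₁)
  by_cases h : c = c₁
  · subst h
    omega
  have h1 : T.dist c c₁ = 1 := by
    have := hc.dist_le_one hT hs hw.center
    have := hT.connected.pos_dist_of_ne h
    omega
  have h2 := hw.nearest c hc
  have h3 := hT.connected.pos_dist_of_ne (Ne.symm hvc)
  rcases hT.dist_step h1 w with h4 | h4
  · have := dist_add_dist_of_between hT (p := c) (q := w) (a := c₁) (x := v) (by omega) hv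
      (by omega)
    omega
  · omega

theorem IsHubOn.dist_eq {c' : V} (h : IsHubOn T s c w) (h' : IsHubOn T s c' w) :
    T.dist c w = T.dist c' w := by
  have h1 := h.nearest c' h'.center
  have h2 := h'.nearest c h.center
  rw [T.dist_comm, T.dist_comm (u := c')]
  omega

theorem IsHubOn.card_bigKids_le (hT : T.IsTree) (h : IsHubOn T s c w) (hne : w ≠ c) :
    (bigKids T s c c).card ≤ 2 :=
  (Finset.card_le_card (bigKids_subset_branchNbrs hT s c c)).trans
    (h.only c (by simp) hne.symm)

/-- A hub other than its nearest center `c` makes every other hub visible from `c`. -/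
theorem IsHubOn.visibleFrom_of_ne (hT : T.IsTree) (hs : GeodConvex T s) (h : IsHubOn T s c w)
    (hne : w ≠ c) {c' w' : V} (h' : IsHubOn T s c' w') : VisibleFrom T s c w' := by
  refine h'.visibleFrom hT hs h.center ?_
  rintro rfl
  have := h.only w' (by simp) hne.symm
  have := h'.three
  omega

theorem VisibleFrom.exists_bigKid (hT : T.IsTree) (hw : VisibleFrom T s c w) :
    ∃ A ∈ bigKids T s c c, w ∈ desc T c A ∧ T.dist c w = T.dist A w + 1 :=
  exists_bigKid_of_mem_desc hT (by simp [mem_desc]) hw.ne.symm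
    (le_trans (by norm_num) (hw.five_le hT (self_mem_desc c w)))

theorem VisibleFrom.ne_of_ne (hT : T.IsTree) (hc : IsCenterOn T s c) (hs : 4 ≤ s.card)
    {w' A B : V} (hw : VisibleFrom T s c w) (hw' : VisibleFrom T s c w') (hne : w ≠ w')
    (hA : A ≠ c) (hwA : w ∈ desc T c A) (hwB : w' ∈ desc T c B) : A ≠ B := by
  rintro rfl
  exact hne (hw.eq_of_mem_desc hT hc hs hw' _ A rfl hA hwA hwB)

theorem ne_of_mem_bigKids {u v : V} (h : u ∈ bigKids T s c v) : u ≠ c := by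
  rintro rfl
  have := (mem_bigKids.mp h).2.1
  simp at this

theorem IsHubOn.not_three_dists (hT : T.IsTree) (hs : GeodConvex T s) (hn : 4 ≤ s.card)
    {c₁ c₂ c₃ w₁ w₂ w₃ : V} (h₁ : IsHubOn T s c₁ w₁) (h₂ : IsHubOn T s c₂ w₂)
    (h₃ : IsHubOn T s c₃ w₃) (h12 : T.dist c₂ w₂ < T.dist c₁ w₁)
    (h23 : T.dist c₃ w₃ < T.dist c₂ w₂) : False := by
  have hne : w₁ ≠ c₁ := by rintro rfl; simp at h12
  have n12 : w₁ ≠ w₂ := by rintro rfl; exact h12.ne (h₂.dist_eq h₁)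
  have n13 : w₁ ≠ w₃ := by rintro rfl; exact (h23.trans h12).ne (h₃.dist_eq h₁)
  have n23 : w₂ ≠ w₃ := by rintro rfl; exact h23.ne (h₃.dist_eq h₂)
  have v₁ := h₁.visibleFrom_of_ne hT hs hne h₁
  have v₂ := h₁.visibleFrom_of_ne hT hs hne h₂
  have v₃ := h₁.visibleFrom_of_ne hT hs hne h₃
  obtain ⟨A, hA, hwA, -⟩ := v₁.exists_bigKid hT
  obtain ⟨B, hB, hwB, -⟩ := v₂.exists_bigKid hT
  obtain ⟨C, hC, hwC, -⟩ := v₃.exists_bigKid hT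
  have hAB := v₁.ne_of_ne hT h₁.center hn v₂ n12 (ne_of_mem_bigKids hA) hwA hwB
  have hAC := v₁.ne_of_ne hT h₁.center hn v₃ n13 (ne_of_mem_bigKids hA) hwA hwC
  have hBC := v₂.ne_of_ne hT h₁.center hn v₃ n23 (ne_of_mem_bigKids hB) hwB hwC
  have h := h₁.card_bigKids_le hT hne
  exact absurd (Finset.two_lt_card.mpr ⟨A, hA, B, hB, C, hC, hAB, hAC, hBC⟩) (by omega)

end Center

section NearCenter

variable {V : Type*} {T : SimpleGraph V}

theorem exists_common_hop (hT : T.IsTree) {x p q : V} (hxp : x ≠ p)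
    (h : T.dist p x + T.dist x q ≠ T.dist p q) :
    ∃ a, T.dist x a = 1 ∧ T.dist x p = T.dist a p + 1 ∧ T.dist x q = T.dist a q + 1 := by
  obtain ⟨a, ha1, ha2⟩ := hT.connected.exists_hop hxp
  refine ⟨a, ha1, ha2, (hT.dist_step ha1 q).resolve_right fun h' => h ?_⟩
  have c1 := T.dist_comm (u := a) (v := x)
  have c2 := T.dist_comm (u := p) (v := x)
  have c3 := T.dist_comm (u := p) (v := a)
  have := hT.dist_across' (v := a) (u := x) (y := p) (x := q) (by omega) ha2 h'
  omega

variable [Fintype V] [DecidableEq V]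

/-- The vertices of `s` which may become centers after moving at most three edges of the subtree
with vertex set `s`. -/
noncomputable def nearCenters (T : SimpleGraph V) (s : Finset V) : Finset V :=
  open Classical in s.filter fun c => ∀ u, T.dist c u = 1 → 2 * (desc T c u ∩ s).card ≤ s.card + 6

variable {s : Finset V}

theorem mem_nearCenters {c : V} : c ∈ nearCenters T s ↔
    c ∈ s ∧ ∀ u, T.dist c u = 1 → 2 * (desc T c u ∩ s).card ≤ s.card + 6 := by
  simp [nearCenters]

theorem IsMove.center_mem_nearCenters (hT : T.IsTree) {s₀ : Finset V} (h : IsMove T s₀ s)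
    (hn : 7 ≤ s₀.card) {c : V} (hc : IsCenterOn T s c) : c ∈ nearCenters T s₀ := by
  refine mem_nearCenters.mpr ⟨h.center_mem hT hn hc, fun u hu => ?_⟩
  have h1 := card_inter_le_add_card_sdiff (desc T c u) s₀ s
  have h2 := h.card_sdiff_le
  have h3 := hc.2 u hu
  have h4 := h.card_eq
  omega

theorem dist_le_seven_of_mem_nearCenters (hT : T.IsTree) (hs : GeodConvex T s) {p q : V}
    (hp : p ∈ nearCenters T s) (hq : q ∈ nearCenters T s) : T.dist p q ≤ 7 := by
  rw [mem_nearCenters] at hp hq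
  by_cases h : p = q
  · simp [h]
  obtain ⟨a, ha1, ha2⟩ := hT.connected.exists_hop h
  obtain ⟨b, hb1, hb2⟩ := hT.connected.exists_hop (Ne.symm h)
  have h1 := card_add_dist_le hT hs hp.1 hq.1 ha1 hb1 (by omega) (by omega)
  have h2 := hp.2 a ha1
  have h3 := hq.2 b hb1
  omega

theorem collinear_of_mem_nearCenters (hT : T.IsTree) (hs : GeodConvex T s) (hn : 17 ≤ s.card)
    {p q x : V} (hp : p ∈ nearCenters T s) (hq : q ∈ nearCenters T s)
    (hx : x ∈ nearCenters T s) (hxp : x ≠ p) (hxq : x ≠ q) (hpq : p ≠ q) :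
    T.dist p x + T.dist x q = T.dist p q ∨ T.dist q p + T.dist p x = T.dist q x ∨
      T.dist x q + T.dist q p = T.dist x p := by
  by_contra! h
  obtain ⟨h1, h2, h3⟩ := h
  rw [mem_nearCenters] at hp hq hx
  obtain ⟨a, ha, hap, haq⟩ := exists_common_hop hT hxp h1
  obtain ⟨b, hb, hbq, hbx⟩ := exists_common_hop hT hpq h2
  obtain ⟨e, he, hex, hep⟩ := exists_common_hop hT hxq.symm h3
  have c1 := T.dist_comm (u := p) (v := x)
  have c2 := T.dist_comm (u := q) (v := x)
  have c3 := T.dist_comm (u := q) (v := p)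
  have c4 := T.dist_comm (u := p) (v := a)
  have c5 := T.dist_comm (u := q) (v := a)
  have c6 := T.dist_comm (u := x) (v := a)
  have hmem : a ∈ s := hs hx.1 hp.1 (by omega)
  have hap0 : T.dist a p ≠ 0 := by
    intro h0
    rw [hT.connected.dist_eq_zero_iff] at h0
    subst h0
    omega
  have haq0 : T.dist a q ≠ 0 := by
    intro h0
    rw [hT.connected.dist_eq_zero_iff] at h0
    subst h0
    omega
  have hsub : ((s \ desc T x a) ∪ (s \ desc T p b)) ∪ (s \ desc T q e) ⊆ s.erase a := by
    have ha1 : a ∈ desc T x a := self_mem_desc x a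
    have ha2 : a ∈ desc T p b := mem_desc.mpr
      (dist_add_dist_of_between hT (q := x) (by omega) (by omega) (by omega))
    have ha3 : a ∈ desc T q e := mem_desc.mpr
      (dist_add_dist_of_between hT (q := x) (by omega) (by omega) (by omega))
    intro y
    simp only [Finset.mem_union, Finset.mem_sdiff, Finset.mem_erase]
    rintro ((h | h) | h) <;> refine ⟨?_, h.1⟩ <;> rintro rfl <;> exact h.2 ‹_›
  have d1 : Disjoint (s \ desc T x a) (s \ desc T p b) := by
    refine Finset.disjoint_left.mpr fun y hy hy' => ?_
    rw [Finset.mem_sdiff] at hy hy'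
    exact (mem_desc_or_mem_desc hT (p := x) (q := p) ha (by omega) (by omega) y).elim hy.2 hy'.2
  have d2 : Disjoint ((s \ desc T x a) ∪ (s \ desc T p b)) (s \ desc T q e) := by
    refine Finset.disjoint_left.mpr fun y hy hy' => ?_
    rw [Finset.mem_union, Finset.mem_sdiff, Finset.mem_sdiff] at hy
    rw [Finset.mem_sdiff] at hy'
    rcases hy with hy | hy
    · exact (mem_desc_or_mem_desc hT (p := x) (q := q) ha (by omega) (by omega) y).elim hy.2 hy'.2
    · exact (mem_desc_or_mem_desc hT (p := p) (q := q) hb (by omega) (by omega) y).elim hy.2 hy'.2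
  have h4 := Finset.card_le_card hsub
  rw [Finset.card_union_of_disjoint d2, Finset.card_union_of_disjoint d1,
    Finset.card_erase_of_mem hmem] at h4
  have e1 := Finset.card_sdiff_add_card_inter s (desc T x a)
  have e2 := Finset.card_sdiff_add_card_inter s (desc T p b)
  have e3 := Finset.card_sdiff_add_card_inter s (desc T q e)
  rw [Finset.inter_comm] at e1 e2 e3
  have f1 := hx.2 a ha
  have f2 := hp.2 b hb
  have f3 := hq.2 e he
  omega

theorem card_nearCenters_le (hT : T.IsTree) (hs : GeodConvex T s) (hn : 17 ≤ s.card) :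
    (nearCenters T s).card ≤ 8 := by
  rcases (nearCenters T s).eq_empty_or_nonempty with h | h
  · simp [h]
  obtain ⟨⟨p, q⟩, hpq, hmax⟩ := Finset.exists_max_image
    (nearCenters T s ×ˢ nearCenters T s) (fun z => T.dist z.1 z.2) (h.product h)
  simp only [Finset.mem_product] at hpq
  obtain ⟨hp, hq⟩ := hpq
  have hmax' : ∀ x ∈ nearCenters T s, ∀ y ∈ nearCenters T s, T.dist x y ≤ T.dist p q :=
    fun x hx y hy => hmax (x, y) (Finset.mk_mem_product hx hy)
  have hbtw : ∀ x ∈ nearCenters T s, T.dist p x + T.dist x q = T.dist p q := by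
    intro x hx
    by_cases hxp : x = p
    · simp [hxp]
    by_cases hxq : x = q
    · simp [hxq]
    have m1 := hmax' x hx q hq
    have m2 := hmax' x hx p hp
    have c1 := T.dist_comm (u := x) (v := p)
    have c2 := T.dist_comm (u := x) (v := q)
    have c3 := T.dist_comm (u := q) (v := p)
    have o1 := hT.connected.pos_dist_of_ne hxp
    have o2 := hT.connected.pos_dist_of_ne hxq
    by_cases hpq : p = q
    · subst hpq
      have h0 : T.dist p p = 0 := dist_self
      omega
    rcases collinear_of_mem_nearCenters hT hs hn hp hq hx hxp hxq hpq with h | h | h <;> omega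
  have hcard : (nearCenters T s).card ≤ (Finset.range 8).card := by
    refine Finset.card_le_card_of_injOn (T.dist p) (fun x hx => ?_) fun x hx y hy hxy => ?_
    · have := dist_le_seven_of_mem_nearCenters hT hs hp (Finset.mem_coe.mp hx)
      simpa using Nat.lt_succ_of_le this
    · exact hT.between_unique (hbtw x hx) (hbtw y hy) hxy
  simpa using hcard

end NearCenter

section MovedHubs

variable {V : Type*} {T : SimpleGraph V} [Fintype V] [DecidableEq V] {s₀ s : Finset V}
  {c c' w w' A : V}

theorem VisibleFrom.two_le (hT : T.IsTree) (hm : IsMove T s₀ s) (hw : VisibleFrom T s c w) :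
    2 ≤ (desc T c w ∩ s₀).card := by
  have h1 := card_inter_le_add_card_sdiff (desc T c w) s s₀
  have h2 := hm.card_sdiff_le'
  have h3 := hw.five_le hT (self_mem_desc c w)
  omega

theorem mem_bigKids_of_desc (hT : T.IsTree) {t : Finset V} (hA : T.dist c A = 1)
    (h : w ∈ desc T c A) (ht : 2 ≤ (desc T c w ∩ t).card) : A ∈ bigKids T t c c :=
  mem_bigKids.mpr ⟨hA, by simpa using hA,
    ht.trans (Finset.card_le_card (Finset.inter_subset_inter_right (desc_subset hT h)))⟩

theorem VisibleFrom.mem_budgetReach (hT : T.IsTree) (hm : IsMove T s₀ s) (hn : 4 ≤ s₀.card)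
    (hc : IsCenterOn T s c) (hw : VisibleFrom T s c w) (hA : T.dist c A = 1)
    (h : w ∈ desc T c A) :
    w ∈ budgetReach (bigKids T s₀ c) (T.dist c w - 1) (desc T c A ∩ (s₀ \ s)).card A := by
  have h2 : 2 ≤ (desc T c w ∩ s).card :=
    le_trans (by norm_num) (hw.five_le hT (self_mem_desc c w))
  have hd := mem_desc.mp h
  refine mem_budgetReach_of_path hT (hw.two_le hT hm) h2 _ A h (by omega) fun x hx hxw hne => ?_
  refine hw.card_bigKids_le hT hc (by rw [hm.card_eq]; exact hn) hxw ?_ hne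
  rintro rfl
  rw [mem_desc, dist_self] at hx
  omega

theorem IsHubOn.sum_card_add_le (hT : T.IsTree) (hm : IsMove T s₀ s) (h : IsHubOn T s c w)
    (hne : w ≠ c) {K : Finset V} (hK : K ⊆ bigKids T s₀ c c ∩ bigKids T s c c) :
    ∑ u ∈ K, (desc T c u ∩ (s₀ \ s)).card + ((bigKids T s₀ c c).card - 2) ≤ 3 := by
  have h1 := card_add_card_sdiff_le hT hK
  have h2 := h.card_bigKids_le hT hne
  have h3 := Finset.card_le_card_sdiff_add_card (s := bigKids T s₀ c c) (t := bigKids T s c c)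
  have h4 := (Finset.card_le_card (Finset.inter_subset_right (s₁ := desc T c c)
    (s₂ := s₀ \ s))).trans hm.card_sdiff_le
  omega

theorem IsHubOn.mem_budgetReach (hT : T.IsTree) (hm : IsMove T s₀ s) (hn : 4 ≤ s₀.card)
    (h : IsHubOn T s c w) (hne : w ≠ c) (hA : T.dist c A = 1) (hw : w ∈ desc T c A) :
    ∃ j, j + ((bigKids T s₀ c c).card - 2) ≤ 3 ∧
      w ∈ budgetReach (bigKids T s₀ c) (T.dist c w - 1) j A := by
  have hv := h.visibleFrom_of_ne hT hm.convex hne h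
  refine ⟨_, ?_, hv.mem_budgetReach hT hm hn h.center hA hw⟩
  have h1 := mem_bigKids_of_desc hT hA hw (hv.two_le hT hm)
  have h2 := mem_bigKids_of_desc hT hA hw
    (le_trans (by norm_num) (hv.five_le hT (self_mem_desc c w)))
  have h3 := h.sum_card_add_le hT hm hne (K := {A}) (by simp [h1, h2])
  rwa [Finset.sum_singleton] at h3

theorem IsHubOn.exists_other (hT : T.IsTree) (hm : IsMove T s₀ s) (hn : 4 ≤ s₀.card)
    (h : IsHubOn T s c w) (hne : w ≠ c) (hA : T.dist c A = 1) (hw : w ∈ desc T c A)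
    (h' : IsHubOn T s c' w') (hd : T.dist c w ≠ T.dist c' w') :
    ∃ B ∈ bigKids T s₀ c c, A ≠ B ∧ ∃ i j, i + j ≤ 3 ∧
      w ∈ budgetReach (bigKids T s₀ c) (T.dist c w - 1) i A ∧
        (budgetReach (bigKids T s₀ c) (T.dist c' w' - 1) j B).Nonempty := by
  have hv := h.visibleFrom_of_ne hT hm.convex hne h
  have hv' := h.visibleFrom_of_ne hT hm.convex hne h'
  have hww : w ≠ w' := by rintro rfl; exact hd (h.dist_eq h')
  obtain ⟨B, hB, hwB, -⟩ := hv'.exists_bigKid hT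
  have hB1 := (mem_bigKids.mp hB).1
  have hA' := mem_bigKids_of_desc hT hA hw
    (le_trans (by norm_num) (hv.five_le hT (self_mem_desc c w)))
  have hA₀ := mem_bigKids_of_desc hT hA hw (hv.two_le hT hm)
  have hB₀ := mem_bigKids_of_desc hT hB1 hwB (hv'.two_le hT hm)
  have hAB := hv.ne_of_ne hT h.center (by rw [hm.card_eq]; exact hn) hv' hww
    (ne_of_mem_bigKids hA') hw hwB
  refine ⟨B, hB₀, hAB, _, _, ?_, hv.mem_budgetReach hT hm hn h.center hA hw,
    budgetReach_nonempty_of_le ?_ ⟨w', hv'.mem_budgetReach hT hm hn h.center hB1 hwB⟩⟩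
  · have h3 := h.sum_card_add_le hT hm hne (K := {A, B}) (by
      intro x
      simp only [Finset.mem_insert, Finset.mem_singleton, Finset.mem_inter]
      rintro (rfl | rfl)
      exacts [⟨hA₀, hA'⟩, ⟨hB₀, hB⟩])
    rw [Finset.sum_pair hAB] at h3
    omega
  · have h3 := h'.nearest c h.center
    have c1 := T.dist_comm (u := w') (v := c)
    have c2 := T.dist_comm (u := w') (v := c')
    omega

/-- `D` is the set of distances from hubs of `T` restricted to `s` to their nearest centers. -/
def HasHubDists (T : SimpleGraph V) (s : Finset V) (D : Set ℕ) : Prop :=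
  ∀ d, d ∈ D ↔ ∃ c w, IsHubOn T s c w ∧ T.dist c w = d

/-- The vertex `w` can become a hub with nearest center `c` after moving at most three edges of
the subtree with vertex set `s₀`, such that `D` becomes the set of distances from hubs to their
nearest centers. -/
def IsMovedHub (T : SimpleGraph V) (s₀ : Finset V) (D : Set ℕ) (c w : V) : Prop :=
  ∃ s, IsMove T s₀ s ∧ HasHubDists T s D ∧ IsHubOn T s c w

/-- The vertices at distance `d` from `c` in the direction of `A` that can become hubs with
nearest center `c`. -/
noncomputable def movedHubs (T : SimpleGraph V) (s₀ : Finset V) (D : Set ℕ) (d : ℕ) (c A : V) :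
    Finset V :=
  open Classical in
    Finset.univ.filter fun w => w ∈ desc T c A ∧ T.dist c w = d ∧ IsMovedHub T s₀ D c w

variable {D : Set ℕ} {d d' : ℕ}

theorem mem_movedHubs : w ∈ movedHubs T s₀ D d c A ↔
    w ∈ desc T c A ∧ T.dist c w = d ∧ IsMovedHub T s₀ D c w := by
  simp [movedHubs]

theorem IsMovedHub.exists_mem_movedHubs (hT : T.IsTree) (h : IsMovedHub T s₀ D c w)
    (hne : w ≠ c) :
    ∃ A ∈ bigKids T s₀ c c, w ∈ movedHubs T s₀ D (T.dist c w) c A := by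
  obtain ⟨s, hm, hD, hw⟩ := h
  have hv := hw.visibleFrom_of_ne hT hm.convex hne hw
  obtain ⟨A, hA, hwA, -⟩ := hv.exists_bigKid hT
  exact ⟨A, mem_bigKids_of_desc hT (mem_bigKids.mp hA).1 hwA (hv.two_le hT hm),
    mem_movedHubs.mpr ⟨hwA, rfl, s, hm, hD, hw⟩⟩

theorem card_movedHubs_le (hT : T.IsTree) (hn : 4 ≤ s₀.card) (hd : 0 < d)
    (hA : T.dist c A = 1) :
    (movedHubs T s₀ D d c A).card ≤ 2 ^ (3 - ((bigKids T s₀ c c).card - 2)) := by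
  refine (Finset.card_le_card fun w hw => ?_).trans
    (card_budgetReach_le (kids := bigKids T s₀ c) (d := d - 1) _ A)
  obtain ⟨hwA, rfl, s, hm, -, hw⟩ := mem_movedHubs.mp hw
  obtain ⟨j, hj, hwj⟩ := hw.mem_budgetReach hT hm hn (by rintro rfl; simp at hd) hA hwA
  exact budgetReach_mono (by omega) hwj

theorem card_bigKids_le_of_mem_movedHubs (hT : T.IsTree) (hn : 4 ≤ s₀.card) (hd : 0 < d)
    (hA : T.dist c A = 1) (hw : w ∈ movedHubs T s₀ D d c A) : (bigKids T s₀ c c).card ≤ 5 := by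
  obtain ⟨hwA, rfl, s, hm, -, hw⟩ := mem_movedHubs.mp hw
  obtain ⟨j, hj, -⟩ := hw.mem_budgetReach hT hm hn (by rintro rfl; simp at hd) hA hwA
  omega

theorem card_movedHubs_le_one (hT : T.IsTree) (hs₀ : GeodConvex T s₀) (hn : 7 ≤ s₀.card)
    (hd : 0 < d) (hA : T.dist c A = 1) (h4 : (desc T c A ∩ s₀).card ≤ 4) :
    (movedHubs T s₀ D d c A).card ≤ 1 := by
  rw [Finset.card_le_one]
  have key : ∀ w ∈ movedHubs T s₀ D d c A,
      w ∈ desc T c A ∧ T.dist c w = d ∧ 2 ≤ (desc T c w ∩ s₀).card ∧ A ∈ s₀ := by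
    intro w hw
    obtain ⟨hwA, rfl, s, hm, -, hw⟩ := mem_movedHubs.mp hw
    have h2 := (hw.visibleFrom_of_ne hT hm.convex (by rintro rfl; simp at hd) hw).two_le hT hm
    refine ⟨hwA, rfl, h2, mem_of_desc_inter_nonempty hs₀ (hm.center_mem hT hn hw.center)
      (u := A) (Finset.card_pos.mp ?_)⟩
    have := Finset.card_le_card
      (Finset.inter_subset_inter_right (u := s₀) (desc_subset hT hwA))
    omega
  intro w hw w' hw'
  obtain ⟨h1, h2, h3, hAs⟩ := key w hw
  obtain ⟨h1', h2', h3', -⟩ := key w' hw'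
  by_contra hne
  have hAd : ∀ x, x ∈ desc T c A → T.dist c x = d → A ∉ desc T c x := by
    intro x hx hxd hAx
    rw [mem_desc] at hx hAx
    have hAx0 : T.dist A x = 0 := by omega
    have e1 := mem_desc.mp h1
    have e2 := mem_desc.mp h1'
    have z1 : T.dist A w = 0 := by omega
    have z2 : T.dist A w' = 0 := by omega
    rw [hT.connected.dist_eq_zero_iff] at z1 z2
    exact hne (z1.symm.trans z2)
  have hdis := desc_disjoint hT (h2.trans h2'.symm) hne
  have hsub : insert A ((desc T c w ∩ s₀) ∪ (desc T c w' ∩ s₀)) ⊆ desc T c A ∩ s₀ := by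
    refine Finset.insert_subset (Finset.mem_inter.mpr ⟨self_mem_desc c A, hAs⟩)
      (Finset.union_subset ?_ ?_)
    exacts [Finset.inter_subset_inter_right (desc_subset hT h1),
      Finset.inter_subset_inter_right (desc_subset hT h1')]
  have hcard := Finset.card_le_card hsub
  rw [Finset.card_insert_of_notMem, Finset.card_union_of_disjoint] at hcard
  · omega
  · exact Finset.disjoint_of_subset_left Finset.inter_subset_left
      (Finset.disjoint_of_subset_right Finset.inter_subset_left hdis)
  · simp [hAd w h1 h2, hAd w' h1' h2']

theorem card_filter_five_le (hT : T.IsTree) (hd : 0 < d) (hw : w ∈ movedHubs T s₀ D d c A) :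
    ((bigKids T s₀ c c).filter fun u => 5 ≤ (desc T c u ∩ s₀).card).card ≤ 2 := by
  obtain ⟨hwA, rfl, s, hm, -, hw⟩ := mem_movedHubs.mp hw
  refine (Finset.card_le_card fun u hu => ?_).trans
    (hw.card_bigKids_le hT (by rintro rfl; simp at hd))
  rw [Finset.mem_filter, mem_bigKids] at hu
  have h1 := card_inter_le_add_card_sdiff (desc T c u) s₀ s
  have h2 := hm.card_sdiff_le
  exact mem_bigKids.mpr ⟨hu.1.1, hu.1.2.1, by omega⟩

/-- The union of the sets `movedHubs T s₀ D d c A` over all relevant directions `A`. -/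
noncomputable def movedHubsAt (T : SimpleGraph V) (s₀ : Finset V) (D : Set ℕ) (d : ℕ) (c : V) :
    Finset V :=
  (bigKids T s₀ c c).biUnion (movedHubs T s₀ D d c)

theorem card_bigKids_le_of_movedHubsAt (hT : T.IsTree) (hn : 4 ≤ s₀.card) (hd : 0 < d)
    (h : (movedHubsAt T s₀ D d c).Nonempty) : (bigKids T s₀ c c).card ≤ 5 := by
  obtain ⟨w, hw⟩ := h
  obtain ⟨A, hA, hw⟩ := Finset.mem_biUnion.mp hw
  exact card_bigKids_le_of_mem_movedHubs hT hn hd (mem_bigKids.mp hA).1 hw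

theorem card_movedHubsAt_le_sixteen (hT : T.IsTree) (hn : 4 ≤ s₀.card) (hd : 0 < d) :
    (movedHubsAt T s₀ D d c).card ≤ 16 := by
  rcases (movedHubsAt T s₀ D d c).eq_empty_or_nonempty with h | h
  · simp [h]
  have h5 := card_bigKids_le_of_movedHubsAt hT hn hd h
  refine (Finset.card_biUnion_le_card_mul _ _ _ fun A hA =>
    card_movedHubs_le hT hn hd (mem_bigKids.mp hA).1).trans ?_
  generalize (bigKids T s₀ c c).card = k at h5 ⊢
  interval_cases k <;> norm_num

theorem card_movedHubsAt_le_nine (hT : T.IsTree) (hs₀ : GeodConvex T s₀) (hn : 7 ≤ s₀.card)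
    (hd : 0 < d) (hk : 3 ≤ (bigKids T s₀ c c).card) : (movedHubsAt T s₀ D d c).card ≤ 9 := by
  rcases (movedHubsAt T s₀ D d c).eq_empty_or_nonempty with h | h
  · simp [h]
  have h5 := card_bigKids_le_of_movedHubsAt hT (by omega) hd h
  obtain ⟨w, hw⟩ := h
  obtain ⟨A, hA, hw⟩ := Finset.mem_biUnion.mp hw
  have h2 := card_filter_five_le hT hd hw
  refine Finset.card_biUnion_le.trans ?_
  rw [← Finset.sum_filter_add_sum_filter_not _ fun u => 5 ≤ (desc T c u ∩ s₀).card]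
  have e1 := Finset.sum_le_card_nsmul
    ((bigKids T s₀ c c).filter fun u => 5 ≤ (desc T c u ∩ s₀).card)
    (fun u => (movedHubs T s₀ D d c u).card) (2 ^ (3 - ((bigKids T s₀ c c).card - 2)))
    (fun u hu => card_movedHubs_le hT (by omega) hd
      (mem_bigKids.mp (Finset.mem_filter.mp hu).1).1)
  have e2 := Finset.sum_le_card_nsmul
    ((bigKids T s₀ c c).filter fun u => ¬ 5 ≤ (desc T c u ∩ s₀).card)
    (fun u => (movedHubs T s₀ D d c u).card) 1
    (fun u hu => card_movedHubs_le_one hT hs₀ hn hd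
      (mem_bigKids.mp (Finset.mem_filter.mp hu).1).1 (by
        have := (Finset.mem_filter.mp hu).2
        omega))
  have e3 := Finset.card_filter_add_card_filter_not (s := bigKids T s₀ c c)
    fun u => 5 ≤ (desc T c u ∩ s₀).card
  refine (Nat.add_le_add e1 e2).trans ?_
  rw [smul_eq_mul, smul_eq_mul]
  generalize ((bigKids T s₀ c c).filter fun u => 5 ≤ (desc T c u ∩ s₀).card).card = x at *
  generalize ((bigKids T s₀ c c).filter fun u => ¬ 5 ≤ (desc T c u ∩ s₀).card).card = y at *
  generalize (bigKids T s₀ c c).card = k at *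
  interval_cases k <;> norm_num <;> omega

theorem exists_other_of_mem_movedHubs (hT : T.IsTree) (hn : 4 ≤ s₀.card) (hd : 0 < d)
    (hd' : d' ∈ D) (hne : d ≠ d') (hA : T.dist c A = 1) (hw : w ∈ movedHubs T s₀ D d c A) :
    ∃ B ∈ bigKids T s₀ c c, A ≠ B ∧ ∃ i j, i + j ≤ 3 ∧
      w ∈ budgetReach (bigKids T s₀ c) (d - 1) i A ∧
        (budgetReach (bigKids T s₀ c) (d' - 1) j B).Nonempty := by
  obtain ⟨hwA, rfl, s, hm, hD, hw⟩ := mem_movedHubs.mp hw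
  obtain ⟨c', w', hw', rfl⟩ := (hD d').mp hd'
  exact hw.exists_other hT hm hn (by rintro rfl; simp at hd) hA hwA hw' hne

theorem card_movedHubs_add_card_movedHubs_le (hT : T.IsTree) (hn : 4 ≤ s₀.card) (h0 : 0 < d)
    (h0' : 0 < d') (hd : d ∈ D) (hd' : d' ∈ D) (hne : d ≠ d') {B : V}
    (hK : bigKids T s₀ c c = {A, B}) :
    (movedHubs T s₀ D d c A).card + (movedHubs T s₀ D d' c B).card ≤ 9 := by
  have hA : A ∈ bigKids T s₀ c c := by simp [hK]
  have hB : B ∈ bigKids T s₀ c c := by simp [hK]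
  refine card_add_card_le_nine (kids := bigKids T s₀ c) (a := d - 1) (b := d' - 1) (A := A)
    (B := B) (fun w hw => ?_) fun w hw => ?_
  · obtain ⟨X, hX, hne', i, j, hij, h1, h2⟩ :=
      exists_other_of_mem_movedHubs hT hn h0 hd' hne (mem_bigKids.mp hA).1 hw
    obtain rfl : X = B := by
      rw [hK, Finset.mem_insert, Finset.mem_singleton] at hX
      exact hX.resolve_left hne'.symm
    exact ⟨i, j, hij, h1, h2⟩
  · obtain ⟨X, hX, hne', i, j, hij, h1, h2⟩ :=
      exists_other_of_mem_movedHubs hT hn h0' hd hne.symm (mem_bigKids.mp hB).1 hw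
    obtain rfl : X = A := by
      rw [hK, Finset.mem_insert, Finset.mem_singleton] at hX
      exact hX.resolve_right hne'.symm
    exact ⟨j, i, by omega, h2, h1⟩

theorem card_movedHubsAt_add_le (hT : T.IsTree) (hs₀ : GeodConvex T s₀) (hn : 7 ≤ s₀.card)
    (h0 : 0 < d) (h0' : 0 < d') (hd : d ∈ D) (hd' : d' ∈ D) (hne : d ≠ d') :
    (movedHubsAt T s₀ D d c).card + (movedHubsAt T s₀ D d' c).card ≤ 18 := by
  by_cases hk : 3 ≤ (bigKids T s₀ c c).card
  · exact Nat.add_le_add (card_movedHubsAt_le_nine hT hs₀ hn h0 hk)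
      (card_movedHubsAt_le_nine hT hs₀ hn h0' hk)
  by_cases hk2 : (bigKids T s₀ c c).card = 2
  · obtain ⟨A, B, hAB, hK⟩ := Finset.card_eq_two.mp hk2
    have h1 := card_movedHubs_add_card_movedHubs_le hT (by omega) h0 h0' hd hd' hne hK
    rw [Finset.pair_comm] at hK
    have h2 := card_movedHubs_add_card_movedHubs_le hT (by omega) h0 h0' hd hd' hne hK
    unfold movedHubsAt
    have h3 := Finset.card_biUnion_le (s := bigKids T s₀ c c) (t := movedHubs T s₀ D d c)
    have h4 := Finset.card_biUnion_le (s := bigKids T s₀ c c) (t := movedHubs T s₀ D d' c)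
    rw [hK, Finset.sum_pair hAB.symm] at h3 h4
    rw [hK]
    omega
  · have hk1 : (bigKids T s₀ c c).card ≤ 1 := by omega
    have hempty : ∀ {e e' : ℕ}, 0 < e → e' ∈ D → e ≠ e' → movedHubsAt T s₀ D e c = ∅ := by
      intro e e' he he' hne'
      rw [Finset.eq_empty_iff_forall_notMem]
      intro w hw
      obtain ⟨A, hA, hw⟩ := Finset.mem_biUnion.mp hw
      obtain ⟨B, hB, hAB, -⟩ := exists_other_of_mem_movedHubs hT (by omega) he he' hne'
        (mem_bigKids.mp hA).1 hw
      exact hAB (Finset.card_le_one.mp hk1 A hA B hB)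
    rw [hempty h0 hd' hne, hempty h0' hd hne.symm]
    simp

theorem IsMovedHub.dist_mem (h : IsMovedHub T s₀ D c w) : T.dist c w ∈ D := by
  obtain ⟨s, -, hD, hw⟩ := h
  exact (hD _).mpr ⟨c, w, hw, rfl⟩

theorem IsMovedHub.mem_movedHubsAt (hT : T.IsTree) (h : IsMovedHub T s₀ D c w) (hne : w ≠ c) :
    w ∈ movedHubsAt T s₀ D (T.dist c w) c :=
  Finset.mem_biUnion.mpr (h.exists_mem_movedHubs hT hne)

theorem IsMovedHub.not_three_dists (hT : T.IsTree) (hn : 4 ≤ s₀.card)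
    (h : IsMovedHub T s₀ D c w) {d₁ d₂ d₃ : ℕ} (h₁ : d₁ ∈ D) (h₂ : d₂ ∈ D) (h₃ : d₃ ∈ D)
    (h12 : d₂ < d₁) (h23 : d₃ < d₂) : False := by
  obtain ⟨s, hm, hD, -⟩ := h
  obtain ⟨c₁, w₁, i₁, rfl⟩ := (hD _).mp h₁
  obtain ⟨c₂, w₂, i₂, rfl⟩ := (hD _).mp h₂
  obtain ⟨c₃, w₃, i₃, rfl⟩ := (hD _).mp h₃
  exact i₁.not_three_dists hT hm.convex (by rw [hm.card_eq]; exact hn) i₂ i₃ h12 h23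

theorem exists_card_le_of_isMovedHub (hT : T.IsTree) (hs₀ : GeodConvex T s₀) (hn : 7 ≤ s₀.card)
    (D : Set ℕ) (c : V) :
    ∃ X : Finset V, X.card ≤ 18 ∧ ∀ w, IsMovedHub T s₀ D c w → w ∈ X := by
  by_cases hex : ∃ d ∈ D, ∃ d' ∈ D, 0 < d ∧ d < d'
  · obtain ⟨d, hd, d', hd', h0, hlt⟩ := hex
    refine ⟨movedHubsAt T s₀ D d c ∪ movedHubsAt T s₀ D d' c, (Finset.card_union_le _ _).trans
      (card_movedHubsAt_add_le hT hs₀ hn h0 (by omega) hd hd' hlt.ne), fun w hw => ?_⟩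
    have hm := hw.dist_mem
    have heq : T.dist c w = d ∨ T.dist c w = d' := by
      by_contra! hne
      rcases lt_or_gt_of_ne hne.1 with h | h
      · exact hw.not_three_dists hT (by omega) hd' hd hm hlt h
      rcases lt_or_gt_of_ne hne.2 with h' | h'
      · exact hw.not_three_dists hT (by omega) hd' hm hd h' h
      · exact hw.not_three_dists hT (by omega) hm hd' hd h' hlt
    have hwc : w ≠ c := by
      rintro rfl
      rw [dist_self] at heq
      omega
    have h := hw.mem_movedHubsAt hT hwc
    rw [Finset.mem_union]
    rcases heq with e | e <;> rw [e] at h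
    exacts [Or.inl h, Or.inr h]
  by_cases hpos : ∃ d ∈ D, 0 < d
  · obtain ⟨d, hd, h0⟩ := hpos
    refine ⟨insert c (movedHubsAt T s₀ D d c), (Finset.card_insert_le _ _).trans ?_,
      fun w hw => ?_⟩
    · have := card_movedHubsAt_le_sixteen (c := c) (D := D) hT (by omega : 4 ≤ s₀.card) h0
      omega
    · rw [Finset.mem_insert, or_iff_not_imp_left]
      intro hwc
      have hm := hw.dist_mem
      have h1 := hT.connected.pos_dist_of_ne (Ne.symm hwc)
      have : T.dist c w = d := by
        by_contra hne
        rcases lt_or_gt_of_ne hne with h | h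
        exacts [hex ⟨_, hm, d, hd, h1, h⟩, hex ⟨d, hd, _, hm, h0, h⟩]
      exact this ▸ hw.mem_movedHubsAt hT hwc
  · refine ⟨{c}, by simp, fun w hw => ?_⟩
    by_contra hwc
    rw [Finset.mem_singleton] at hwc
    exact hpos ⟨_, hw.dist_mem, hT.connected.pos_dist_of_ne (Ne.symm hwc)⟩

theorem exists_hubs_superset (hT : T.IsTree) (hs₀ : GeodConvex T s₀) (hn : 17 ≤ s₀.card)
    (D : Set ℕ) :
    ∃ X : Finset V, X.card ≤ 144 ∧ ∀ c w, IsMovedHub T s₀ D c w → w ∈ X := by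
  choose X hX hmem using exists_card_le_of_isMovedHub hT hs₀ (by omega : 7 ≤ s₀.card) D
  refine ⟨(nearCenters T s₀).biUnion X, ?_, fun c w hw => ?_⟩
  · exact (Finset.card_biUnion_le_card_mul _ _ _ fun c _ => hX c).trans
      (Nat.mul_le_mul_right 18 (card_nearCenters_le hT hs₀ hn))
  · refine Finset.mem_biUnion.mpr ⟨c, ?_, hmem c w hw⟩
    obtain ⟨s, hm, -, hw⟩ := hw
    exact hm.center_mem_nearCenters hT (by omega) hw.center

end MovedHubs

/-- Let S be a non-caterpillar tree with at least 17 vertices and fix (the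
vertex set of) an embedding s0 of a tree with |S| vertices in a tree T.  There is a set
X of at most 144 vertices of T such that if an embedding of S in T is obtained by
moving three or fewer edges of s0, then each hub of the obtained embedding lies in X. -/
theorem hubs_after_moving_edges {V W : Type*} [Fintype V] [DecidableEq V] [Fintype W]
    (S : SimpleGraph W) (hS : S.IsTree) (hnc : ¬ IsCaterpillar S)
    (h17 : 17 ≤ Fintype.card W)
    (T : SimpleGraph V) (hT : T.IsTree)
    (s0 : Finset V) (hs0 : (T.induce (s0 : Set V)).Connected)
    (hcard : s0.card = Fintype.card W) :
    ∃ X : Finset V, X.card ≤ 144 ∧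
      ∀ s : Finset V, s.card = s0.card → Nonempty ((T.induce (s : Set V)) ≃g S) →
        (T.induce ((s0 ∩ s : Finset V) : Set V)).Connected →
        s0.card - 3 ≤ (s0 ∩ s).card →
        ∀ (w : V) (hw : w ∈ s),
          IsHub (T.induce (s : Set V)) ⟨w, Finset.mem_coe.mpr hw⟩ → w ∈ X := by
  obtain ⟨X, hX, hmem⟩ := exists_hubs_superset hT (geodConvex_of_connected hT hs0)
    (hcard ▸ h17) (hubDists S)
  refine ⟨X, hX, fun s hs hiso hinter hle w hw hhub => ?_⟩
  obtain ⟨f⟩ := hiso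
  have hconn : (T.induce (s : Set V)).Connected := f.connected_iff.mpr hS.connected
  obtain ⟨c, hc⟩ := (isHub_induce_iff hT hconn _).mp hhub
  refine hmem c w ⟨s, ⟨geodConvex_of_connected hT hconn, geodConvex_of_connected hT hinter, hs,
    by omega⟩, fun d => ?_, hc⟩
  rw [← hubDists_iso f hconn]
  exact mem_hubDists_induce_iff hT hconn d
end

section
/- Let T be a tree with maximum degree Δ ≥ 2, let e be an edge of T, and let k ≥ 2. The number of k-vertex subtrees of T that contain the edge e is at most (k-1)^{k-1} (Δ-1)^{k-1}. -/
open SimpleGraph Filter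

open Classical in
/-- The vertex sets obtained from `s` by adjoining `n` vertices one at a time, each adjacent to a
vertex already present. -/
noncomputable def growth {V : Type*} [Fintype V] (G : SimpleGraph V) (s : Finset V) :
    ℕ → Finset (Finset V)
  | 0 => {s}
  | n + 1 => (growth G s n).biUnion fun t =>
      (t.biUnion fun x => G.neighborFinset x \ t).image fun y => insert y t

theorem mem_growth_succ {V : Type*} [Fintype V] [DecidableEq V] {G : SimpleGraph V}
    {s r : Finset V} {n : ℕ} :
    r ∈ growth G s (n + 1) ↔
      ∃ t ∈ growth G s n, ∃ x ∈ t, ∃ y, G.Adj x y ∧ y ∉ t ∧ insert y t = r := by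
  simp only [growth, Finset.mem_biUnion, Finset.mem_image, Finset.mem_sdiff, mem_neighborFinset]
  constructor
  · rintro ⟨t, ht, y, ⟨x, hx, hxy, hy⟩, rfl⟩
    exact ⟨t, ht, x, hx, y, hxy, hy, by ext; simp⟩
  · rintro ⟨t, ht, x, hx, y, hxy, hy, rfl⟩
    exact ⟨t, ht, y, ⟨x, hx, hxy, hy⟩, by ext; simp⟩

theorem card_of_mem_growth {V : Type*} [Fintype V] {G : SimpleGraph V} {s : Finset V} {n : ℕ}
    {t : Finset V} (ht : t ∈ growth G s n) : t.card = s.card + n := by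
  classical
  induction n generalizing t with
  | zero => simp_all [growth]
  | succ n ih =>
    obtain ⟨r, hr, -, -, y, -, hy, rfl⟩ := mem_growth_succ.1 ht
    rw [Finset.card_insert_of_notMem hy, ih hr, add_assoc]

theorem exists_adj_of_mem_growth {V : Type*} [Fintype V] {G : SimpleGraph V} {s : Finset V}
    (hs : ∀ x ∈ s, ∃ y ∈ s, G.Adj x y) {n : ℕ} {t : Finset V} (ht : t ∈ growth G s n) :
    ∀ x ∈ t, ∃ y ∈ t, G.Adj x y := by
  classical
  induction n generalizing t with
  | zero =>
    obtain rfl : t = s := by simpa [growth] using ht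
    exact hs
  | succ n ih =>
    obtain ⟨r, hr, x, hx, y, hxy, -, rfl⟩ := mem_growth_succ.1 ht
    intro z hz
    obtain rfl | hz := Finset.mem_insert.1 hz
    · exact ⟨x, Finset.mem_insert_of_mem hx, hxy.symm⟩
    · obtain ⟨w, hw, h⟩ := ih hr z hz
      exact ⟨w, Finset.mem_insert_of_mem hw, h⟩

theorem card_growth_succ_le {V : Type*} [Fintype V] {G : SimpleGraph V} {s : Finset V}
    (hs : ∀ x ∈ s, ∃ y ∈ s, G.Adj x y) {Δ : ℕ} (hΔ : ∀ x, ndeg G x ≤ Δ) (n : ℕ) :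
    (growth G s (n + 1)).card ≤ (growth G s n).card * ((s.card + n) * (Δ - 1)) := by
  classical
  rw [growth]
  refine Finset.card_biUnion_le_card_mul _ _ _ fun t ht => Finset.card_image_le.trans ?_
  rw [← card_of_mem_growth ht]
  refine Finset.card_biUnion_le_card_mul _ _ _ fun x hx => ?_
  obtain ⟨y, hy, hxy⟩ := exists_adj_of_mem_growth hs ht x hx
  have hdeg : (G.neighborFinset x).card ≤ Δ :=
    (Set.ncard_eq_toFinset_card' (G.neighborSet x)).symm.trans_le (hΔ x)
  have hy' : y ∈ G.neighborFinset x := (G.mem_neighborFinset x y).2 hxy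
  calc (G.neighborFinset x \ t).card ≤ ((G.neighborFinset x).erase y).card := by
        refine Finset.card_le_card fun z hz => ?_
        rw [Finset.mem_sdiff] at hz
        exact Finset.mem_erase.2 ⟨fun h => hz.2 (h ▸ hy), hz.1⟩
    _ = (G.neighborFinset x).card - 1 := Finset.card_erase_of_mem hy'
    _ ≤ Δ - 1 := Nat.sub_le_sub_right hdeg 1

/-- In a connected vertex set `s`, every proper nonempty subset has a neighbour in `s`. -/
theorem exists_adj_of_connected_induce {V : Type*} {G : SimpleGraph V} {s t : Set V}
    (hs : (G.induce s).Connected) (hts : t ⊂ s) (ht : t.Nonempty) :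
    ∃ x ∈ t, ∃ y ∈ s, y ∉ t ∧ G.Adj x y := by
  obtain ⟨a, ha⟩ := ht
  obtain ⟨b, hb, hbt⟩ := Set.exists_of_ssubset hts
  obtain ⟨p⟩ := hs.preconnected ⟨a, hts.1 ha⟩ ⟨b, hb⟩
  obtain ⟨d, -, h₁, h₂⟩ := p.exists_boundary_dart (Subtype.val ⁻¹' t) ha hbt
  exact ⟨d.fst, h₁, d.snd, d.snd.2, h₂, d.adj⟩

theorem exists_mem_growth_subset {V : Type*} [Fintype V] {G : SimpleGraph V} {s r : Finset V}
    (hs : s.Nonempty) (hsr : s ⊆ r) (hr : (G.induce (r : Set V)).Connected) {n : ℕ}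
    (hn : s.card + n ≤ r.card) : ∃ t ∈ growth G s n, t ⊆ r := by
  classical
  induction n with
  | zero => exact ⟨s, by simp [growth], hsr⟩
  | succ n ih =>
    obtain ⟨t, ht, htr⟩ := ih (by omega)
    have hcard := card_of_mem_growth ht
    have hssub : t ⊂ r := Finset.ssubset_iff_subset_ne.2 ⟨htr, by rintro rfl; omega⟩
    have hne : t.Nonempty := Finset.card_pos.1 (by have := hs.card_pos; omega)
    obtain ⟨x, hx, y, hy, hyt, hxy⟩ :=
      exists_adj_of_connected_induce hr (Finset.coe_ssubset.2 hssub) (Finset.coe_nonempty.2 hne)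
    exact ⟨insert y t, mem_growth_succ.2 ⟨t, ht, x, hx, y, hxy, hyt, rfl⟩,
      Finset.insert_subset hy htr⟩

theorem card_growth_pair_le {V : Type*} [Fintype V] [DecidableEq V] {G : SimpleGraph V}
    {u v : V} (huv : G.Adj u v) {Δ : ℕ} (hΔ : ∀ x, ndeg G x ≤ Δ) (n : ℕ) :
    (growth G {u, v} n).card ≤ (n + 1).factorial * (Δ - 1) ^ n := by
  have hs : ∀ x ∈ ({u, v} : Finset V), ∃ y ∈ ({u, v} : Finset V), G.Adj x y := by
    simp [huv, huv.symm]
  induction n with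
  | zero => simp [growth]
  | succ n ih =>
    refine (card_growth_succ_le hs hΔ n).trans ((Nat.mul_le_mul_right _ ih).trans_eq ?_)
    rw [Finset.card_pair huv.ne, Nat.factorial_succ (n + 1)]
    ring

/-- Let T be a tree with maximum degree Δ ≥ 2, let uv be an edge of
T, and let k ≥ 2.  The number of k-vertex subtrees of T containing the edge uv is at
most (k-1)^(k-1) * (Δ-1)^(k-1). -/
theorem subtrees_through_edge_le {V : Type*} [Fintype V]
    (T : SimpleGraph V) (hT : T.IsTree)
    (Δ : ℕ) (hΔ2 : 2 ≤ Δ) (hΔub : ∀ x : V, ndeg T x ≤ Δ) (hΔmem : ∃ x : V, ndeg T x = Δ)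
    (u v : V) (huv : T.Adj u v) (k : ℕ) (hk : 2 ≤ k) :
    {s : Finset V | s.card = k ∧ (T.induce (s : Set V)).Connected ∧ u ∈ s ∧ v ∈ s}.ncard ≤
      (k - 1) ^ (k - 1) * (Δ - 1) ^ (k - 1) := by
  classical
  obtain ⟨n, rfl⟩ := Nat.exists_eq_add_of_le hk
  have hsub : {s : Finset V | s.card = 2 + n ∧ (T.induce (s : Set V)).Connected ∧ u ∈ s ∧ v ∈ s} ⊆
      (growth T {u, v} n : Set (Finset V)) := by
    rintro s ⟨hcard, hconn, hu, hv⟩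
    have hpair := Finset.card_pair huv.ne
    obtain ⟨t, ht, hts⟩ := exists_mem_growth_subset (n := n) (Finset.insert_nonempty u {v})
      (Finset.insert_subset hu (Finset.singleton_subset_iff.2 hv)) hconn (by omega)
    have htcard := card_of_mem_growth ht
    rwa [← Finset.eq_of_subset_of_card_le hts (by omega)]
  have hk' : 2 + n - 1 = n + 1 := by omega
  rw [hk']
  calc _ ≤ (growth T {u, v} n).card := by
        simpa only [Set.ncard_coe_finset] using Set.ncard_le_ncard hsub (Finset.finite_toSet _)
    _ ≤ (n + 1).factorial * (Δ - 1) ^ n := card_growth_pair_le huv hΔub n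
    _ ≤ (n + 1) ^ (n + 1) * (Δ - 1) ^ (n + 1) :=
        Nat.mul_le_mul (Nat.factorial_le_pow _)
          (Nat.pow_le_pow_right (by omega) (Nat.le_succ n))
end

section
/- For every integer k ≥ 1, the sum over j from 0 to k of (j+1) · C(3k, k-j) is at most 4 · C(3k, k), where C(n, m) denotes the binomial coefficient. -/
open SimpleGraph Filter

/-- In the first third of a row of Pascal's triangle, consecutive entries at least double. -/
theorem two_mul_choose_le_choose_succ {n r : ℕ} (h : 3 * r + 2 ≤ n) :
    2 * n.choose r ≤ n.choose (r + 1) := by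
  refine Nat.le_of_mul_le_mul_right ?_ r.succ_pos
  rw [Nat.succ_eq_add_one, Nat.choose_succ_right_eq, mul_comm 2, mul_assoc]
  exact Nat.mul_le_mul_left _ (by omega)

/-- The coefficient `2 * m + 4` is the tail `∑ i, (m + 1 + i) / 2 ^ i` of the dominating
geometric series. -/
theorem sum_weighted_binomials_add_tail_le {k m : ℕ} (hm : m ≤ k) :
    (∑ j ∈ Finset.range m, (j + 1) * Nat.choose (3 * k) (k - j)) +
      (2 * m + 4) * Nat.choose (3 * k) (k - m) ≤ 4 * Nat.choose (3 * k) k := by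
  induction m with
  | zero => simp
  | succ m ih =>
    have ih := ih (by omega)
    have hc : 2 * (3 * k).choose (k - (m + 1)) ≤ (3 * k).choose (k - m) := by
      have := two_mul_choose_le_choose_succ (n := 3 * k) (r := k - (m + 1)) (by omega)
      rwa [show k - (m + 1) + 1 = k - m by omega] at this
    rw [Finset.sum_range_succ]
    nlinarith [Nat.mul_le_mul_left (m + 3) hc]

/-- For every k ≥ 1,
∑_{j=0}^{k} (j+1) C(3k, k-j) ≤ 4 C(3k, k). -/
theorem sum_weighted_binomials_le (k : ℕ) (hk : 1 ≤ k) :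
    (∑ j ∈ Finset.range (k + 1), (j + 1) * Nat.choose (3 * k) (k - j)) ≤
      4 * Nat.choose (3 * k) k := by
  have h := sum_weighted_binomials_add_tail_le (le_refl k)
  rw [Finset.sum_range_succ]
  nlinarith [Nat.zero_le ((k + 3) * Nat.choose (3 * k) (k - k))]
end
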